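/- arXiv:2003.08528 — 2 statements merged into one kernel-verified Lean document; each statement's English description precedes it below -/
import Mathlib

section
/- Let Z₁, Z₂,... be real-valued random variables with characteristic functions φ_N(t) = E[e^{itZ_N}], and suppose that for some m ∈ ℝ and σ² > 0 the sequence N^{−1/2}(Z_N − mN) converges in distribution to a centered normal law with variance σ². Assume: (A1) there exist δ₀ ∈ (0,1), constants c₀,d₀ > 0 and a sequence (b_N) with N^{1/2} b_N → 0 such that |φ_N(t)| ≤ c₀ e^{−d₀Nt²} + b_N for all N ∈ ℕ and t ∈ [−δ₀,δ₀]; (A2) for every δ > 0, N^{1/2} sup_{t ∈ J_δ} |φ_N(t)| → 0 as N → ∞, where J_δ = [−δ^{−1},−δ] ∪ [δ,δ^{−1}]. Then for any real continuous function g on ℝ with compact support (or the indicator of a bounded interval), lim_{N→∞} sup_{u∈ℝ} | σ√(2πN) E[g(Z_N − u)] − e^{−(u − mN)²/(2Nσ²)} ∫ g(x) dx | = 0. -/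
open MeasureTheory ProbabilityTheory Filter
open scoped ENNReal NNReal

/-- The transform `x ↦ ∫ k(t) e^{itx} dt` of a function `k` on the line. -/
noncomputable def expTransform (k : ℝ → ℂ) (x : ℝ) : ℂ :=
  ∫ t, k t * Complex.exp (Complex.I * Complex.ofReal (t * x))

lemma norm_exp_I_mul_ofReal (x : ℝ) : ‖Complex.exp (Complex.I * Complex.ofReal x)‖ = 1 := by
  rw [mul_comm, Complex.norm_exp_ofReal_mul_I]

/-- The triangle function `(1 - |t|)⁺`. -/
noncomputable def triangle (t : ℝ) : ℝ := max 0 (1 - |t|)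

lemma continuous_triangle : Continuous triangle := by unfold triangle; fun_prop

lemma triangle_zero : triangle 0 = 1 := by simp [triangle]

lemma triangle_eq_zero {t : ℝ} (ht : 1 ≤ |t|) : triangle t = 0 := max_eq_left (by linarith)

lemma hasCompactSupport_triangle : HasCompactSupport triangle :=
  HasCompactSupport.intro (isCompact_Icc (a := -1) (b := 1)) fun t ht =>
    triangle_eq_zero (by
      by_contra! h
      exact ht ⟨(abs_lt.1 h).1.le, (abs_lt.1 h).2.le⟩)

lemma integrable_triangle : Integrable triangle :=
  continuous_triangle.integrable_of_hasCompactSupport hasCompactSupport_triangle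

lemma expTransform_triangle_of_ne_zero {x : ℝ} (hx : x ≠ 0) :
    expTransform (fun t => (triangle t : ℂ)) x = ((Real.sinc (x / 2) ^ 2 : ℝ) : ℂ) := by
  have hsupp : expTransform (fun t => (triangle t : ℂ)) x =
      ∫ t in (-1 : ℝ)..1, (triangle t : ℂ) * Complex.exp (Complex.I * Complex.ofReal (t * x)) := by
    rw [expTransform, intervalIntegral.integral_of_le (by norm_num)]
    refine (setIntegral_eq_integral_of_forall_compl_eq_zero fun t ht => ?_).symm
    rw [triangle_eq_zero, Complex.ofReal_zero, zero_mul]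
    by_contra! h
    exact ht ⟨(abs_lt.1 h).1, (abs_lt.1 h).2.le⟩
  have hcont : Continuous fun t : ℝ =>
      (triangle t : ℂ) * Complex.exp (Complex.I * Complex.ofReal (t * x)) := by
    have := continuous_triangle
    fun_prop
  have hx' : (x : ℂ) ≠ 0 := by exact_mod_cast hx
  have hexp (t : ℝ) : HasDerivAt (fun s : ℝ => Complex.exp (Complex.I * Complex.ofReal (s * x)))
      (Complex.exp (Complex.I * Complex.ofReal (t * x)) * (Complex.I * x)) t := by
    have h1 : HasDerivAt (fun s : ℝ => Complex.I * Complex.ofReal (s * x)) (Complex.I * x) t := by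
      have := (((hasDerivAt_id t).mul_const x).ofReal_comp).const_mul Complex.I
      simpa using this
    exact h1.cexp
  have hid (t : ℝ) : HasDerivAt (fun s : ℝ => (s : ℂ)) 1 t := by
    simpa using (hasDerivAt_id t).ofReal_comp
  have hright : ∫ t in (0 : ℝ)..1,
        (triangle t : ℂ) * Complex.exp (Complex.I * Complex.ofReal (t * x)) =
      Complex.exp (Complex.I * x) / (Complex.I * x) ^ 2
        - (1 / (Complex.I * x) + 1 / (Complex.I * x) ^ 2) := by
    have := intervalIntegral.integral_eq_sub_of_hasDerivAt
      (f := fun t : ℝ => (1 - (t : ℂ)) * Complex.exp (Complex.I * Complex.ofReal (t * x))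
          / (Complex.I * x) + Complex.exp (Complex.I * Complex.ofReal (t * x))
          / (Complex.I * x) ^ 2)
      (f' := fun t : ℝ => (triangle t : ℂ) * Complex.exp (Complex.I * Complex.ofReal (t * x)))
      (a := 0) (b := 1) ?_ (hcont.intervalIntegrable _ _)
    · rw [this]; simp
    · intro t ht
      rw [Set.uIcc_of_le zero_le_one] at ht
      have ht' : triangle t = 1 - t := by
        rw [triangle, abs_of_nonneg ht.1, max_eq_right (by linarith [ht.2])]
      rw [ht']
      refine (((((hid t).const_sub 1).mul (hexp t)).div_const (Complex.I * x)).add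
        ((hexp t).div_const ((Complex.I * x) ^ 2))).congr_deriv ?_
      push_cast
      field_simp
      ring
  have hleft : ∫ t in (-1 : ℝ)..0,
        (triangle t : ℂ) * Complex.exp (Complex.I * Complex.ofReal (t * x)) =
      1 / (Complex.I * x) - 1 / (Complex.I * x) ^ 2
        + Complex.exp (-(Complex.I * x)) / (Complex.I * x) ^ 2 := by
    have := intervalIntegral.integral_eq_sub_of_hasDerivAt
      (f := fun t : ℝ => (1 + (t : ℂ)) * Complex.exp (Complex.I * Complex.ofReal (t * x))
          / (Complex.I * x) - Complex.exp (Complex.I * Complex.ofReal (t * x))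
          / (Complex.I * x) ^ 2)
      (f' := fun t : ℝ => (triangle t : ℂ) * Complex.exp (Complex.I * Complex.ofReal (t * x)))
      (a := -1) (b := 0) ?_ (hcont.intervalIntegrable _ _)
    · rw [this]; simp
    · intro t ht
      rw [Set.uIcc_of_le (by norm_num)] at ht
      have ht' : triangle t = 1 + t := by
        rw [triangle, abs_of_nonpos ht.2, max_eq_right (by linarith [ht.1])]
        ring
      rw [ht']
      refine (((((hid t).const_add 1).mul (hexp t)).div_const (Complex.I * x)).sub
        ((hexp t).div_const ((Complex.I * x) ^ 2))).congr_deriv ?_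
      push_cast
      field_simp
      ring
  rw [hsupp, ← intervalIntegral.integral_add_adjacent_intervals
    (hcont.intervalIntegrable (-1) 0) (hcont.intervalIntegrable 0 1), hleft, hright,
    Real.sinc_of_ne_zero (by simpa using hx)]
  have hcos : Complex.exp (Complex.I * x) + Complex.exp (-(Complex.I * x)) =
      2 - 4 * Complex.sin (x / 2) ^ 2 := by
    have h1 := Complex.two_cos (x : ℂ)
    have h2 : Complex.cos (x : ℂ) = 1 - 2 * Complex.sin (x / 2) ^ 2 := by
      have := Complex.cos_two_mul ((x : ℂ) / 2)
      rw [mul_div_cancel₀ _ two_ne_zero] at this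
      rw [this, Complex.cos_sq']
      ring
    rw [h2] at h1
    rw [show Complex.I * (x : ℂ) = x * Complex.I by ring, ← neg_mul, ← h1]
    ring
  push_cast
  have hI : (Complex.I * (x : ℂ)) ^ 2 = -(x : ℂ) ^ 2 := by
    rw [mul_pow, Complex.I_sq]; ring
  rw [hI]
  field_simp
  linear_combination (-Complex.I) * hcos

lemma continuous_expTransform {k : ℝ → ℂ} (hk : Integrable k) : Continuous (expTransform k) := by
  refine continuous_of_dominated (bound := fun t => ‖k t‖) (fun x => ?_)
    (fun x => ae_of_all _ fun t => ?_) hk.norm (ae_of_all _ fun t => by fun_prop)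
  · exact hk.aestronglyMeasurable.mul (by fun_prop : Continuous _).aestronglyMeasurable
  · rw [norm_mul, norm_exp_I_mul_ofReal, mul_one]

lemma expTransform_triangle (x : ℝ) :
    expTransform (fun t => (triangle t : ℂ)) x = ((Real.sinc (x / 2) ^ 2 : ℝ) : ℂ) := by
  have h1 := continuous_expTransform (integrable_triangle.ofReal (𝕜 := ℂ))
  have h2 : Continuous fun x : ℝ => ((Real.sinc (x / 2) ^ 2 : ℝ) : ℂ) := by
    have := Real.continuous_sinc
    fun_prop
  exact congrFun (h1.ext_on (dense_compl_singleton (0 : ℝ)) h2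
    fun x hx => expTransform_triangle_of_ne_zero hx) x

/-- The Fejér kernel on the line, normalised to have total mass one. -/
noncomputable def fejerKernel (x : ℝ) : ℝ := Real.sinc (x / 2) ^ 2 / (2 * Real.pi)

lemma continuous_fejerKernel : Continuous fejerKernel := by
  have := Real.continuous_sinc
  unfold fejerKernel
  fun_prop

lemma fejerKernel_nonneg (x : ℝ) : 0 ≤ fejerKernel x := by
  unfold fejerKernel; positivity

lemma sinc_sq_mul_sq (y : ℝ) : Real.sinc y ^ 2 * y ^ 2 = Real.sin y ^ 2 := by
  rcases eq_or_ne y 0 with rfl | hy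
  · simp
  · rw [Real.sinc_of_ne_zero hy]; field_simp

lemma fejerKernel_mul_sq_le (x : ℝ) : fejerKernel x * x ^ 2 ≤ 1 := by
  have h1 := sinc_sq_mul_sq (x / 2)
  have h2 := Real.sin_sq_le_one (x / 2)
  have h3 := Real.pi_gt_three
  rw [fejerKernel, div_mul_eq_mul_div, div_le_one (by positivity)]
  nlinarith

lemma fejerKernel_le_one (x : ℝ) : fejerKernel x ≤ 1 := by
  have h1 : Real.sinc (x / 2) ^ 2 ≤ 1 := by
    rw [sq_le_one_iff_abs_le_one]; exact Real.abs_sinc_le_one _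
  have h3 := Real.pi_gt_three
  rw [fejerKernel, div_le_one (by positivity)]
  linarith

lemma integrable_fejerKernel : Integrable fejerKernel := by
  refine (integrable_inv_one_add_sq.const_mul 2).mono'
    continuous_fejerKernel.aestronglyMeasurable (ae_of_all _ fun x => ?_)
  rw [Real.norm_of_nonneg (fejerKernel_nonneg x), ← div_eq_mul_inv, le_div_iff₀ (by positivity)]
  nlinarith [fejerKernel_mul_sq_le x, fejerKernel_le_one x]

lemma integral_fejerKernel : ∫ x, fejerKernel x = 1 := by
  have hF (w : ℝ) : FourierTransform.fourier (fun t => (triangle t : ℂ)) w =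
      ((2 * Real.pi * fejerKernel (-2 * Real.pi * w) : ℝ) : ℂ) := by
    have hpi := Real.pi_pos
    rw [fejerKernel, mul_div_cancel₀ _ (by positivity), ← expTransform_triangle, expTransform,
      Real.fourier_real_eq_integral_exp_smul]
    congr with t
    rw [smul_eq_mul, mul_comm]
    congr 2
    push_cast
    ring
  have hscale : (-2 * Real.pi) ≠ 0 := by simp [Real.pi_ne_zero]
  have hint : Integrable (FourierTransform.fourier (fun t => (triangle t : ℂ))) := by
    rw [funext hF]
    exact ((integrable_fejerKernel.comp_mul_left' hscale).const_mul _).ofReal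
  have hinv := (integrable_triangle.ofReal (𝕜 := ℂ)).fourierInv_fourier_eq hint (v := 0)
    (Complex.continuous_ofReal.comp continuous_triangle).continuousAt
  change FourierTransformInv.fourierInv (FourierTransform.fourier fun t => (triangle t : ℂ)) 0
    = (triangle 0 : ℂ) at hinv
  rw [Real.fourierInv_eq, triangle_zero] at hinv
  simp only [inner_zero_right, AddChar.map_zero_eq_one, one_smul, hF] at hinv
  rw [integral_complex_ofReal] at hinv
  have h := Complex.ofReal_injective hinv
  rw [integral_const_mul, Measure.integral_comp_mul_left, smul_eq_mul, abs_inv, abs_mul, abs_neg,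
    abs_of_pos Real.pi_pos, abs_two, ← mul_assoc, mul_inv_cancel₀ (by positivity), one_mul] at h
  exact h

/-- Two translates of the Fejér kernel dominate a multiple of an inverse square. -/
lemma inv_sq_le_sinc_sq_add (x : ℝ) :
    4 / (|x| + Real.pi) ^ 2 ≤ Real.sinc (x / 2) ^ 2 + Real.sinc ((x + Real.pi) / 2) ^ 2 := by
  have hpi := Real.pi_pos
  have h0 := abs_nonneg x
  rw [div_le_iff₀ (by positivity)]
  have h1 := sinc_sq_mul_sq (x / 2)
  have h2 := sinc_sq_mul_sq ((x + Real.pi) / 2)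
  rw [add_div, Real.sin_add_pi_div_two, ← add_div] at h2
  have h3 := Real.sin_sq_add_cos_sq (x / 2)
  have h4 : x ^ 2 ≤ (|x| + Real.pi) ^ 2 := by
    rw [← sq_abs]; gcongr; linarith
  have h5 : (x + Real.pi) ^ 2 ≤ (|x| + Real.pi) ^ 2 := by
    rw [← sq_abs (x + Real.pi)]
    gcongr
    simpa [abs_of_pos hpi] using abs_add_le x Real.pi
  nlinarith [mul_le_mul_of_nonneg_left h4 (sq_nonneg (Real.sinc (x / 2))),
    mul_le_mul_of_nonneg_left h5 (sq_nonneg (Real.sinc ((x + Real.pi) / 2)))]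

lemma exists_setIntegral_fejerKernel_le {ε : ℝ} (hε : 0 < ε) :
    ∃ Y : ℝ, 0 < Y ∧ ∫ y in {y : ℝ | Y < |y|}, fejerKernel y ≤ ε := by
  have h := tendsto_setIntegral_of_antitone (μ := volume) (f := fejerKernel)
    (s := fun n : ℕ => {y : ℝ | (n : ℝ) < |y|})
    (fun n => measurableSet_lt measurable_const continuous_abs.measurable)
    (fun n n' hn y (hy : (n' : ℝ) < |y|) => lt_of_le_of_lt (by exact_mod_cast hn) hy)
    ⟨0, integrable_fejerKernel.integrableOn⟩
  have hempty : ⋂ n : ℕ, {y : ℝ | (n : ℝ) < |y|} = ∅ := by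
    refine Set.eq_empty_of_forall_notMem fun y hy => ?_
    obtain ⟨n, hn⟩ := exists_nat_gt |y|
    exact lt_asymm hn (Set.mem_iInter.1 hy n)
  rw [hempty, setIntegral_empty] at h
  obtain ⟨n, hn, hn'⟩ := ((h.eventually_le_const hε).and (eventually_gt_atTop 0)).exists
  exact ⟨n, by exact_mod_cast hn', hn⟩

/-- Fejér means of a bounded uniformly continuous function converge uniformly. -/
lemma eventually_abs_sub_fejer_le {g : ℝ → ℝ} (hg : UniformContinuous g) {M : ℝ}
    (hM : ∀ x, |g x| ≤ M) {ε : ℝ} (hε : 0 < ε) :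
    ∀ᶠ l : ℝ in atTop, ∀ x, |g x - ∫ y, g (x - y / l) * fejerKernel y| ≤ ε := by
  have hM0 : 0 ≤ M := (abs_nonneg _).trans (hM 0)
  obtain ⟨η, hη, hgη⟩ := Metric.uniformContinuous_iff.1 hg (ε / 2) (by positivity)
  obtain ⟨Y, hY, hYK⟩ := exists_setIntegral_fejerKernel_le
    (show 0 < ε / (4 * M + 1) by positivity)
  have hmeas : MeasurableSet {y : ℝ | Y < |y|} :=
    measurableSet_lt measurable_const continuous_abs.measurable
  filter_upwards [eventually_gt_atTop (Y / η), eventually_gt_atTop 0] with l hl hl0 x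
  have hint : Integrable fun y => g (x - y / l) * fejerKernel y :=
    integrable_fejerKernel.bdd_mul (c := M)
      (hg.continuous.comp (by fun_prop)).aestronglyMeasurable (ae_of_all _ fun y => hM _)
  have hint' : Integrable fun y => g x * fejerKernel y := integrable_fejerKernel.const_mul _
  have heq : g x - ∫ y, g (x - y / l) * fejerKernel y =
      ∫ y, (g x * fejerKernel y - g (x - y / l) * fejerKernel y) := by
    rw [integral_sub hint' hint, integral_const_mul, integral_fejerKernel, mul_one]
  rw [heq]
  have hbound : Integrable fun y => ε / 2 * fejerKernel y +
      {y : ℝ | Y < |y|}.indicator (fun y => 2 * M * fejerKernel y) y :=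
    (integrable_fejerKernel.const_mul _).add
      ((integrable_fejerKernel.const_mul _).indicator hmeas)
  rw [← Real.norm_eq_abs]
  refine (norm_integral_le_of_norm_le hbound (ae_of_all _ fun y => ?_)).trans ?_
  · rw [← sub_mul, norm_mul, Real.norm_eq_abs, Real.norm_of_nonneg (fejerKernel_nonneg y)]
    have hK := fejerKernel_nonneg y
    by_cases hy : Y < |y|
    · rw [Set.indicator_of_mem (by exact hy)]
      have : |g x - g (x - y / l)| ≤ 2 * M := by
        linarith [abs_sub (g x) (g (x - y / l)), hM x, hM (x - y / l)]
      nlinarith [mul_le_mul_of_nonneg_right this hK]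
    · rw [Set.indicator_of_notMem (by exact hy), add_zero]
      have hd : dist x (x - y / l) < η := by
        rw [Real.dist_eq, sub_sub_cancel, abs_div, abs_of_pos hl0, div_lt_iff₀ hl0]
        rw [div_lt_iff₀ hη] at hl
        linarith [not_lt.1 hy]
      exact mul_le_mul_of_nonneg_right (hgη hd).le hK
  · rw [integral_add (integrable_fejerKernel.const_mul _)
      ((integrable_fejerKernel.const_mul _).indicator hmeas), integral_const_mul,
      integral_fejerKernel, integral_indicator hmeas, integral_const_mul]
    have h1 : 2 * M * ∫ y in {y : ℝ | Y < |y|}, fejerKernel y ≤ 2 * M * (ε / (4 * M + 1)) := by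
      gcongr
    have h2 : 2 * M * (ε / (4 * M + 1)) ≤ ε / 2 := by
      rw [← mul_div_assoc, div_le_iff₀ (by positivity)]
      nlinarith
    linarith

/-- Decay of the Fejér means of a compactly supported function. -/
lemma abs_fejer_mul_sq_le {g : ℝ → ℝ} (hg : Integrable g) {R : ℝ}
    (hR : ∀ x, R < |x| → g x = 0) {l : ℝ} (hl : 0 < l) {x : ℝ} (hx : 2 * R < |x|)
    (hx0 : x ≠ 0) :
    |∫ y, g (x - y / l) * fejerKernel y| * x ^ 2 ≤ 4 / l * ∫ z, |g z| := by
  have hxsq : 0 < x ^ 2 := by positivity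
  have hscale (F : ℝ → ℝ) : ∫ y, F (x - y / l) = l * ∫ z, F z := by
    have h1 := Measure.integral_comp_div (fun y => F (x - y)) l
    rw [h1, integral_sub_left_eq_self F volume x, smul_eq_mul, abs_of_pos hl]
  have hint : Integrable fun y => |g (x - y / l)| * (4 / (l ^ 2 * x ^ 2)) :=
    (((hg.comp_sub_left x).comp_div hl.ne').abs).mul_const _
  have key : |∫ y, g (x - y / l) * fejerKernel y| ≤ l * (∫ z, |g z|) * (4 / (l ^ 2 * x ^ 2)) := by
    rw [← hscale fun z => |g z|, ← integral_mul_const]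
    rw [← Real.norm_eq_abs]
    refine norm_integral_le_of_norm_le hint (ae_of_all _ fun y => ?_)
    rw [norm_mul, Real.norm_eq_abs, Real.norm_of_nonneg (fejerKernel_nonneg y)]
    by_cases hy : R < |x - y / l|
    · rw [hR _ hy]; simp
    · gcongr
      have h1 : |x| ≤ |x - y / l| + |y / l| := by
        simpa using abs_add_le (x - y / l) (y / l)
      have h2 : |x| / 2 ≤ |y| / l := by
        rw [abs_div, abs_of_pos hl] at h1
        linarith [not_lt.1 hy]
      have h3 : l * |x| ≤ 2 * |y| := by
        rw [div_le_div_iff₀ two_pos hl] at h2; linarith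
      have h4 : l ^ 2 * x ^ 2 ≤ 4 * y ^ 2 := by
        rw [← sq_abs x, ← sq_abs y]
        nlinarith [mul_self_le_mul_self (by positivity) h3]
      rw [le_div_iff₀ (by positivity)]
      nlinarith [fejerKernel_mul_sq_le y, mul_le_mul_of_nonneg_left h4 (fejerKernel_nonneg y)]
  calc _ ≤ l * (∫ z, |g z|) * (4 / (l ^ 2 * x ^ 2)) * x ^ 2 := by gcongr
    _ = _ := by field_simp

/-- The Fejér means of a continuous compactly supported function converge to it at a rate
dominated by translates of the Fejér kernel. -/
lemma eventually_abs_sub_fejer_le_sinc {g : ℝ → ℝ} (hg : Continuous g)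
    (hgs : HasCompactSupport g) {ε : ℝ} (hε : 0 < ε) :
    ∀ᶠ l : ℝ in atTop, ∀ x, |g x - ∫ y, g (x - y / l) * fejerKernel y| ≤
      ε * (Real.sinc (x / 2) ^ 2 + Real.sinc ((x + Real.pi) / 2) ^ 2) := by
  obtain ⟨M, hM⟩ := hgs.exists_bound_of_continuous hg
  obtain ⟨R', hR'⟩ := hgs.isCompact.isBounded.subset_closedBall (0 : ℝ)
  set R := max R' Real.pi
  have hpi := Real.pi_pos
  have hRpi : Real.pi ≤ R := le_max_right _ _
  have hR : ∀ x, R < |x| → g x = 0 := fun x hx => by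
    by_contra h
    have := hR' (subset_tsupport g h)
    rw [mem_closedBall_zero_iff, Real.norm_eq_abs] at this
    exact absurd (this.trans (le_max_left R' Real.pi)) (not_le.2 hx)
  have hint := hg.integrable_of_hasCompactSupport hgs (μ := volume)
  have hlim : Tendsto (fun l : ℝ => 4 / l * ∫ z, |g z|) atTop (nhds 0) := by
    simpa using (tendsto_id.const_div_atTop (4 : ℝ)).mul_const (∫ z, |g z|)
  filter_upwards [eventually_abs_sub_fejer_le (hgs.uniformContinuous_of_continuous hg) hM
    (show 0 < ε * (4 / (2 * R + Real.pi) ^ 2) by positivity), eventually_gt_atTop 0,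
    hlim.eventually_le_const hε] with l h1 hl h2 x
  refine le_trans ?_ (mul_le_mul_of_nonneg_left (inv_sq_le_sinc_sq_add x) hε.le)
  by_cases hx : 2 * R < |x|
  · have hx0 : x ≠ 0 := by
      rintro rfl
      rw [abs_zero] at hx
      linarith
    have h3 := (abs_fejer_mul_sq_le hint hR hl hx hx0).trans h2
    rw [hR x (by linarith), zero_sub, abs_neg, ← mul_div_assoc, le_div_iff₀ (by positivity)]
    have h4 : (|x| + Real.pi) ^ 2 ≤ 4 * x ^ 2 := by
      rw [← sq_abs x]
      nlinarith [abs_nonneg x]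
    nlinarith [abs_nonneg (∫ y, g (x - y / l) * fejerKernel y)]
  · refine (h1 x).trans ?_
    have := not_lt.1 hx
    gcongr

lemma expTransform_triangle_div {l : ℝ} (hl : 0 < l) (w : ℝ) :
    expTransform (fun t => (((2 * Real.pi)⁻¹ * triangle (t / l) : ℝ) : ℂ)) w =
      ((l * fejerKernel (l * w) : ℝ) : ℂ) := by
  have h1 := Measure.integral_comp_div (fun s : ℝ => (((2 * Real.pi)⁻¹ : ℝ) : ℂ) *
    ((triangle s : ℂ) * Complex.exp (Complex.I * Complex.ofReal (s * (l * w))))) l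
  have h2 := expTransform_triangle (l * w)
  rw [expTransform] at h2 ⊢
  rw [integral_const_mul (r := (((2 * Real.pi)⁻¹ : ℝ) : ℂ)) (f := fun s : ℝ => (triangle s : ℂ) *
    Complex.exp (Complex.I * Complex.ofReal (s * (l * w)))), h2, abs_of_pos hl] at h1
  rw [fejerKernel]
  convert h1 using 1
  · congr with t
    rw [show t / l * (l * w) = t * w by field_simp]
    push_cast
    ring
  · rw [Complex.real_smul]
    push_cast
    ring

/-- A Fejér mean is the transform of a compactly supported function. -/
lemma expTransform_fejer {g : ℝ → ℝ} (hg : Integrable g) {l : ℝ} (hl : 0 < l) (x : ℝ) :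
    expTransform (fun t => (((2 * Real.pi)⁻¹ * triangle (t / l) : ℝ) : ℂ) *
      expTransform (fun z => (g z : ℂ)) (-t)) x =
      ((∫ y, g (x - y / l) * fejerKernel y : ℝ) : ℂ) := by
  have htri : Integrable fun t : ℝ => (((2 * Real.pi)⁻¹ * triangle (t / l) : ℝ) : ℂ) :=
    ((integrable_triangle.comp_div hl.ne').const_mul _).ofReal
  have hprod : Integrable (Function.uncurry fun t z : ℝ =>
      (((2 * Real.pi)⁻¹ * triangle (t / l) : ℝ) : ℂ) * (g z : ℂ) *
        Complex.exp (Complex.I * Complex.ofReal (t * (x - z)))) := by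
    refine ((htri.mul_prod (hg.ofReal (𝕜 := ℂ))).mul_bdd (c := 1) ?_ ?_)
    · exact (by fun_prop : Continuous fun p : ℝ × ℝ =>
        Complex.exp (Complex.I * Complex.ofReal (p.1 * (x - p.2)))).aestronglyMeasurable
    · exact ae_of_all _ fun p => (norm_exp_I_mul_ofReal _).le
  have h1 : expTransform (fun t => (((2 * Real.pi)⁻¹ * triangle (t / l) : ℝ) : ℂ) *
      expTransform (fun z => (g z : ℂ)) (-t)) x =
      ∫ t : ℝ, ∫ z : ℝ, (((2 * Real.pi)⁻¹ * triangle (t / l) : ℝ) : ℂ) * (g z : ℂ) *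
        Complex.exp (Complex.I * Complex.ofReal (t * (x - z))) := by
    rw [expTransform]
    congr with t
    rw [expTransform, ← integral_const_mul, ← integral_mul_const]
    congr with z
    rw [mul_assoc, mul_assoc, mul_assoc, ← Complex.exp_add]
    congr 3
    push_cast
    ring_nf
  rw [h1, integral_integral_swap hprod]
  have h2 (z : ℝ) : ∫ t : ℝ, (((2 * Real.pi)⁻¹ * triangle (t / l) : ℝ) : ℂ) * (g z : ℂ) *
        Complex.exp (Complex.I * Complex.ofReal (t * (x - z))) =
      ((g z * (l * fejerKernel (l * (x - z))) : ℝ) : ℂ) := by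
    rw [Complex.ofReal_mul, ← expTransform_triangle_div hl, expTransform, ← integral_const_mul]
    congr with t
    ring
  simp_rw [h2]
  rw [integral_complex_ofReal]
  congr 1
  have h3 := Measure.integral_comp_div (fun y => g (x - y) * (l * fejerKernel (l * y))) l
  rw [← integral_sub_left_eq_self _ volume x]
  simp only [sub_sub_cancel]
  rw [abs_of_pos hl, smul_eq_mul] at h3
  have h4 : ∫ y, g (x - y / l) * (l * fejerKernel (l * (y / l))) =
      l * ∫ y, g (x - y / l) * fejerKernel y := by
    rw [← integral_const_mul]
    congr with y
    rw [mul_div_cancel₀ _ hl.ne']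
    ring
  exact mul_left_cancel₀ hl.ne' (h3.symm.trans h4)

/-- Approximation of a continuous compactly supported function by band-limited ones, with an
error dominated by translates of the Fejér kernel. -/
lemma exists_expTransform_approx {g : ℝ → ℝ} (hg : Continuous g) (hgs : HasCompactSupport g)
    {ε : ℝ} (hε : 0 < ε) :
    ∃ k : ℝ → ℂ, Continuous k ∧ HasCompactSupport k ∧
      2 * Real.pi * k 0 = ((∫ x, g x : ℝ) : ℂ) ∧
      ∀ x, ‖(g x : ℂ) - expTransform k x‖ ≤
        ε * (Real.sinc (x / 2) ^ 2 + Real.sinc ((x + Real.pi) / 2) ^ 2) := by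
  obtain ⟨l, hl, hl0⟩ :=
    ((eventually_abs_sub_fejer_le_sinc hg hgs hε).and (eventually_gt_atTop 0)).exists
  have hint := hg.integrable_of_hasCompactSupport hgs (μ := volume)
  refine ⟨fun t => (((2 * Real.pi)⁻¹ * triangle (t / l) : ℝ) : ℂ) *
    expTransform (fun z => (g z : ℂ)) (-t), ?_, ?_, ?_, fun x => ?_⟩
  rotate_left 3
  · rw [expTransform_fejer hint hl0, ← Complex.ofReal_sub, Complex.norm_real]
    exact hl x
  · have h1 := continuous_triangle
    have h2 := continuous_expTransform (hint.ofReal (𝕜 := ℂ))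
    fun_prop
  · refine HasCompactSupport.mul_right (HasCompactSupport.intro
      (isCompact_Icc (a := -l) (b := l)) fun t ht => ?_)
    rw [triangle_eq_zero, mul_zero, Complex.ofReal_zero]
    by_contra! h
    rw [abs_div, abs_of_pos hl0, div_lt_one hl0, abs_lt] at h
    exact ht ⟨h.1.le, h.2.le⟩
  · have hpi : (Real.pi : ℂ) ≠ 0 := by exact_mod_cast Real.pi_ne_zero
    beta_reduce
    rw [zero_div, triangle_zero, expTransform, ← integral_complex_ofReal]
    simp only [neg_zero, mul_zero, Complex.ofReal_zero, Complex.exp_zero, mul_one]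
    push_cast
    field_simp

lemma tendsto_integral_norm_sub_of_gaussian_bound {k γ : ℝ → ℂ} {ψ : ℕ → ℝ → ℂ}
    (hk : Continuous k) {L M : ℝ} (hL0 : 0 ≤ L) (hL : ∀ t, L < |t| → k t = 0)
    (hM : ∀ t, ‖k t‖ ≤ M) (hψ : ∀ N, Continuous (ψ N)) (hγ : Integrable γ)
    (hlim : ∀ s, Tendsto (fun N => ψ N s) atTop (nhds (γ s)))
    {δ₀ c₀ d₀ : ℝ} (hc₀ : 0 ≤ c₀) (hd₀ : 0 < d₀) {b S : ℕ → ℝ}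
    (hb : Tendsto (fun N : ℕ => Real.sqrt N * b N) atTop (nhds 0))
    (hS : Tendsto (fun N : ℕ => Real.sqrt N * S N) atTop (nhds 0))
    (h1 : ∀ N : ℕ, 0 < N → ∀ s, |s| ≤ δ₀ * Real.sqrt N →
      ‖ψ N s‖ ≤ c₀ * Real.exp (-d₀ * s ^ 2) + b N)
    (h2 : ∀ N : ℕ, 0 < N → ∀ s, δ₀ * Real.sqrt N ≤ |s| → |s| ≤ L * Real.sqrt N →
      ‖ψ N s‖ ≤ S N) :
    Tendsto (fun N : ℕ => ∫ s, ‖k (s / Real.sqrt N) * ψ N s - k 0 * γ s‖) atTop (nhds 0) := by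
  have hM0 : 0 ≤ M := (norm_nonneg _).trans (hM 0)
  set X : ℕ → ℝ → ℝ := fun N s => ‖k (s / Real.sqrt N) * ψ N s - k 0 * γ s‖ with hX
  set B : ℝ → ℝ := fun s => M * (c₀ * Real.exp (-d₀ * s ^ 2)) + ‖k 0 * γ s‖ with hB
  have hB0 (s : ℝ) : 0 ≤ B s := by positivity
  have hBint : Integrable B :=
    (((integrable_exp_neg_mul_sq hd₀).const_mul c₀).const_mul M).add (hγ.const_mul (k 0)).norm
  have hXmeas (N : ℕ) : AEStronglyMeasurable (X N) :=
    (((by fun_prop : Continuous fun s => k (s / Real.sqrt N)).mul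
      (hψ N)).aestronglyMeasurable.sub (hγ.const_mul (k 0)).aestronglyMeasurable).norm
  have hmin : Tendsto (fun N => ∫ s, min (X N s) (B s)) atTop (nhds 0) := by
    have h := tendsto_integral_of_dominated_convergence (F := fun N s => min (X N s) (B s))
      (f := fun _ => (0 : ℝ)) B (fun N => (hXmeas N).inf hBint.aestronglyMeasurable) hBint
      (fun N => ae_of_all _ fun s => ?_) (ae_of_all _ fun s => ?_)
    · simpa using h
    · rw [Real.norm_of_nonneg (le_min (norm_nonneg _) (hB0 s))]
      exact min_le_right _ _
    · have hsq : Tendsto (fun N : ℕ => s / Real.sqrt N) atTop (nhds 0) :=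
        (Real.tendsto_sqrt_atTop.comp tendsto_natCast_atTop_atTop).const_div_atTop s
      have h3 : Tendsto (fun N => X N s) atTop (nhds 0) := by
        have := ((((hk.tendsto 0).comp hsq).mul (hlim s)).sub_const (k 0 * γ s)).norm
        simpa using this
      have h4 := h3.min (tendsto_const_nhds (x := B s))
      rwa [min_eq_left (hB0 s)] at h4
  set C : ℕ → ℝ := fun N => M * (|b N| + |S N|) with hC
  have hC0 (N : ℕ) : 0 ≤ C N := by positivity
  have hClim : Tendsto (fun N : ℕ => 2 * (L * Real.sqrt N) * C N) atTop (nhds 0) := by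
    have h := (hb.abs.add hS.abs).const_mul (2 * L * M)
    simp only [abs_zero, add_zero, mul_zero] at h
    refine h.congr fun N => ?_
    rw [abs_mul, abs_mul, abs_of_nonneg (Real.sqrt_nonneg _)]
    ring
  have hsum := hmin.add hClim
  rw [add_zero] at hsum
  refine tendsto_of_tendsto_of_tendsto_of_le_of_le' tendsto_const_nhds hsum
    (.of_forall fun N => integral_nonneg fun s => norm_nonneg _) ?_
  filter_upwards [eventually_gt_atTop 0] with N hN
  have hN' : 0 < Real.sqrt N := Real.sqrt_pos.2 (by exact_mod_cast hN)
  have hminint : Integrable fun s => min (X N s) (B s) :=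
    hBint.mono' ((hXmeas N).inf hBint.aestronglyMeasurable) (ae_of_all _ fun s => by
      rw [Real.norm_of_nonneg (le_min (norm_nonneg _) (hB0 s))]
      exact min_le_right _ _)
  let J : Set ℝ := Set.Icc (-(L * Real.sqrt N)) (L * Real.sqrt N)
  have hindint : Integrable (J.indicator fun _ => C N) :=
    (integrable_indicator_iff measurableSet_Icc).2 (integrableOn_const measure_Icc_lt_top.ne)
  have hval : ∫ s, (min (X N s) (B s) + J.indicator (fun _ => C N) s) =
      (∫ s, min (X N s) (B s)) + 2 * (L * Real.sqrt N) * C N := by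
    rw [integral_add hminint hindint, integral_indicator measurableSet_Icc, setIntegral_const,
      Real.volume_real_Icc_of_le (by linarith [mul_nonneg hL0 hN'.le]), smul_eq_mul]
    ring
  rw [← hval]
  refine integral_mono_of_nonneg (ae_of_all _ fun s => norm_nonneg _) (hminint.add hindint)
    (ae_of_all _ fun s => ?_)
  change X N s ≤ min (X N s) (B s) + J.indicator (fun _ => C N) s
  by_cases hs : |s| ≤ L * Real.sqrt N
  · rw [Set.indicator_of_mem (show s ∈ J from abs_le.1 hs), ← min_add_add_right]
    refine le_min (le_add_of_nonneg_right (hC0 N)) ?_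
    have hψN : ‖ψ N s‖ ≤ c₀ * Real.exp (-d₀ * s ^ 2) + (|b N| + |S N|) := by
      rcases le_total |s| (δ₀ * Real.sqrt N) with h | h
      · linarith [h1 N hN s h, le_abs_self (b N), abs_nonneg (S N)]
      · have : 0 ≤ c₀ * Real.exp (-d₀ * s ^ 2) := by positivity
        linarith [h2 N hN s h hs, le_abs_self (S N), abs_nonneg (b N)]
    calc X N s ≤ ‖k (s / Real.sqrt N)‖ * ‖ψ N s‖ + ‖k 0 * γ s‖ := by
          rw [← norm_mul]; exact norm_sub_le _ _
      _ ≤ M * (c₀ * Real.exp (-d₀ * s ^ 2) + (|b N| + |S N|)) + ‖k 0 * γ s‖ := by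
          gcongr
          exact hM _
      _ = B s + C N := by simp only [hB, hC]; ring
  · rw [Set.indicator_of_notMem (show s ∉ J from fun h => hs (abs_le.2 h)), add_zero]
    refine le_min le_rfl ?_
    have : k (s / Real.sqrt N) = 0 := hL _ (by
      rw [abs_div, abs_of_pos hN', lt_div_iff₀ hN']
      exact not_le.1 hs)
    simp only [hX, hB, this, zero_mul, zero_sub, norm_neg]
    have : 0 ≤ M * (c₀ * Real.exp (-d₀ * s ^ 2)) := by positivity
    linarith

lemma integral_exp_I_eq_cos_add_sin {Ω : Type*} [MeasurableSpace Ω] (P : Measure Ω)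
    [IsProbabilityMeasure P] {X : Ω → ℝ} (hX : Measurable X) :
    ∫ ω, Complex.exp (Complex.I * Complex.ofReal (X ω)) ∂P =
      ((∫ ω, Real.cos (X ω) ∂P : ℝ) : ℂ) + ((∫ ω, Real.sin (X ω) ∂P : ℝ) : ℂ) * Complex.I := by
  have hc : Integrable (fun ω => Real.cos (X ω)) P :=
    Integrable.of_bound (Real.measurable_cos.comp hX).aestronglyMeasurable 1
      (ae_of_all _ fun ω => Real.abs_cos_le_one _)
  have hs : Integrable (fun ω => Real.sin (X ω)) P :=
    Integrable.of_bound (Real.measurable_sin.comp hX).aestronglyMeasurable 1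
      (ae_of_all _ fun ω => Real.abs_sin_le_one _)
  rw [← integral_complex_ofReal, ← integral_complex_ofReal, ← integral_mul_const,
    ← integral_add hc.ofReal (hs.ofReal.mul_const _)]
  congr with ω
  rw [mul_comm, Complex.exp_mul_I]
  push_cast
  rfl

/-- Convergence in distribution to a Gaussian law implies pointwise convergence of the
characteristic functions. -/
lemma tendsto_integral_exp_I_of_clt {Ω : Type*} [MeasurableSpace Ω] (P : Measure Ω)
    [IsProbabilityMeasure P] {Y : ℕ → Ω → ℝ} (hY : ∀ N, Measurable (Y N)) {σ : ℝ} {v : ℝ≥0}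
    (hv : (v : ℝ) = σ ^ 2) (hCLT : ∀ f : BoundedContinuousFunction ℝ ℝ, Tendsto (fun N : ℕ => ∫ ω, f (Y N ω) ∂P) atTop
      (nhds (∫ x, f x ∂(gaussianReal 0 v)))) (s : ℝ) :
    Tendsto (fun N => ∫ ω, Complex.exp (Complex.I * Complex.ofReal (s * Y N ω)) ∂P) atTop
      (nhds (Complex.exp (-((σ ^ 2 / 2 : ℝ) : ℂ) * (s : ℂ) ^ 2))) := by
  have hcos := hCLT (BoundedContinuousFunction.ofNormedAddCommGroup (fun x => Real.cos (s * x))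
    (by fun_prop) 1 fun x => Real.abs_cos_le_one _)
  have hsin := hCLT (BoundedContinuousFunction.ofNormedAddCommGroup (fun x => Real.sin (s * x))
    (by fun_prop) 1 fun x => Real.abs_sin_le_one _)
  simp only [BoundedContinuousFunction.coe_ofNormedAddCommGroup] at hcos hsin
  have hγ : Complex.exp (-((σ ^ 2 / 2 : ℝ) : ℂ) * (s : ℂ) ^ 2) =
      ∫ x, Complex.exp (Complex.I * Complex.ofReal (s * x)) ∂(gaussianReal 0 v) := by
    have h := charFun_gaussianReal (μ := 0) (v := v) s
    rw [charFun_apply_real] at h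
    have h' : ∀ x : ℝ, Complex.exp (Complex.I * Complex.ofReal (s * x)) =
        Complex.exp (s * x * Complex.I) := fun x => by
      push_cast; rw [mul_comm]
    simp_rw [h']
    rw [h, show ((v : ℝ) : ℂ) = ((σ ^ 2 : ℝ) : ℂ) by rw [hv]]
    congr 1
    push_cast
    simp
    ring
  rw [hγ, integral_exp_I_eq_cos_add_sin _ (by fun_prop)]
  simp_rw [fun N => integral_exp_I_eq_cos_add_sin P ((hY N).const_mul s)]
  exact ((Complex.continuous_ofReal.tendsto _).comp hcos).add
    (((Complex.continuous_ofReal.tendsto _).comp hsin).mul_const _)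

lemma continuous_integral_exp_I {Ω : Type*} [MeasurableSpace Ω] (P : Measure Ω)
    [IsProbabilityMeasure P] {X : Ω → ℝ} (hX : Measurable X) :
    Continuous fun t : ℝ => ∫ ω, Complex.exp (Complex.I * Complex.ofReal (t * X ω)) ∂P := by
  refine continuous_of_dominated (bound := fun _ => 1) (fun t => ?_)
    (fun t => ae_of_all _ fun ω => (norm_exp_I_mul_ofReal _).le) (integrable_const _)
    (ae_of_all _ fun ω => by fun_prop)
  exact (by fun_prop : Measurable _).aestronglyMeasurable

lemma norm_integral_exp_I_le_one {Ω : Type*} [MeasurableSpace Ω] (P : Measure Ω)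
    [IsProbabilityMeasure P] (X : Ω → ℝ) :
    ‖∫ ω, Complex.exp (Complex.I * Complex.ofReal (X ω)) ∂P‖ ≤ 1 := by
  simpa using norm_integral_le_of_norm_le_const (μ := P)
    (ae_of_all _ fun ω => (norm_exp_I_mul_ofReal (X ω)).le)

lemma integral_expTransform_sub {Ω : Type*} [MeasurableSpace Ω] (P : Measure Ω)
    [IsProbabilityMeasure P] {X : Ω → ℝ} (hX : Measurable X) {k : ℝ → ℂ} (hk : Integrable k)
    (u : ℝ) :
    ∫ ω, expTransform k (X ω - u) ∂P =
      ∫ t, k t * ∫ ω, Complex.exp (Complex.I * Complex.ofReal (t * (X ω - u))) ∂P := by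
  have hprod : Integrable (Function.uncurry fun (ω : Ω) (t : ℝ) =>
      k t * Complex.exp (Complex.I * Complex.ofReal (t * (X ω - u)))) (P.prod volume) := by
    refine (hk.comp_snd P).mul_bdd (c := 1) ?_ (ae_of_all _ fun p => (norm_exp_I_mul_ofReal _).le)
    exact (by fun_prop : Measurable fun p : Ω × ℝ =>
      Complex.exp (Complex.I * Complex.ofReal (p.2 * (X p.1 - u)))).aestronglyMeasurable
  simp only [expTransform]
  rw [integral_integral_swap hprod]
  simp_rw [integral_const_mul]

lemma integral_exp_I_mul_gaussian {σ : ℝ} (hσ : 0 < σ) (v : ℝ) :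
    ∫ s : ℝ, Complex.exp (Complex.I * Complex.ofReal (-(s * v))) *
      Complex.exp (-((σ ^ 2 / 2 : ℝ) : ℂ) * (s : ℂ) ^ 2) =
      ((Real.sqrt (2 * Real.pi) / σ * Real.exp (-v ^ 2 / (2 * σ ^ 2)) : ℝ) : ℂ) := by
  have h := fourierIntegral_gaussian (b := ((σ ^ 2 / 2 : ℝ) : ℂ))
    (by rw [Complex.ofReal_re]; positivity) (-v : ℂ)
  have hpow : ((Real.pi : ℂ) / ((σ ^ 2 / 2 : ℝ) : ℂ)) ^ (1 / 2 : ℂ) =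
      ((Real.sqrt (2 * Real.pi) / σ : ℝ) : ℂ) := by
    rw [← Complex.ofReal_div, show (1 / 2 : ℂ) = ((1 / 2 : ℝ) : ℂ) by push_cast; rfl,
      ← Complex.ofReal_cpow (by positivity), ← Real.sqrt_eq_rpow,
      show Real.pi / (σ ^ 2 / 2) = 2 * Real.pi / σ ^ 2 by field_simp,
      Real.sqrt_div (by positivity), Real.sqrt_sq hσ.le]
  rw [hpow] at h
  rw [Complex.ofReal_mul, Complex.ofReal_exp]
  convert h using 3
  · congr 2
    push_cast
    ring
  · push_cast
    field_simp
    ring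

lemma integral_exp_I_sub {Ω : Type*} [MeasurableSpace Ω] (P : Measure Ω) (X : Ω → ℝ)
    (t a u : ℝ) :
    ∫ ω, Complex.exp (Complex.I * Complex.ofReal (t * (X ω - u))) ∂P =
      Complex.exp (Complex.I * Complex.ofReal (t * (a - u))) *
        ∫ ω, Complex.exp (Complex.I * Complex.ofReal (t * (X ω - a))) ∂P := by
  rw [← integral_const_mul]
  congr with ω
  rw [← Complex.exp_add]
  congr 1
  push_cast
  ring

/-- `σ√(2πN) E[f(Z_N - u)]` is asymptotic to `e^{-(u - mN)² / (2Nσ²)} c`, uniformly in `u`. -/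
def LocalLimit {Ω E : Type*} [MeasurableSpace Ω] [NormedAddCommGroup E] [NormedSpace ℝ E]
    (P : Measure Ω) (Z : ℕ → Ω → ℝ) (m σ : ℝ) (f : ℝ → E) (c : E) : Prop :=
  ∀ ε : ℝ, 0 < ε → ∀ᶠ N : ℕ in atTop, ∀ u : ℝ,
    ‖(σ * Real.sqrt (2 * Real.pi * N)) • (∫ ω, f (Z N ω - u) ∂P)
      - Real.exp (-((u - m * N) ^ 2) / (2 * N * σ ^ 2)) • c‖ ≤ ε

/-- The local limit theorem for band-limited test functions. -/
lemma localLimit_expTransform {Ω : Type*} [MeasurableSpace Ω] (P : Measure Ω)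
    [IsProbabilityMeasure P] (Z : ℕ → Ω → ℝ) (hZmeas : ∀ N, Measurable (Z N))
    (m σ : ℝ) (hσ : 0 < σ) {v : ℝ≥0} (hv : (v : ℝ) = σ ^ 2)
    (hCLT : ∀ f : BoundedContinuousFunction ℝ ℝ,
      Tendsto (fun N : ℕ => ∫ ω, f ((Z N ω - m * N) / Real.sqrt N) ∂P) atTop
        (nhds (∫ x, f x ∂(gaussianReal 0 v))))
    (hA1 : ∃ δ₀ ∈ Set.Ioo (0 : ℝ) 1, ∃ c₀ > (0 : ℝ), ∃ d₀ > (0 : ℝ), ∃ b : ℕ → ℝ,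
      Tendsto (fun N : ℕ => Real.sqrt N * b N) atTop (nhds 0) ∧
      ∀ N : ℕ, ∀ t ∈ Set.Icc (-δ₀) δ₀,
        ‖∫ ω, Complex.exp (Complex.I * Complex.ofReal (t * Z N ω)) ∂P‖
          ≤ c₀ * Real.exp (-d₀ * N * t ^ 2) + b N)
    (hA2 : ∀ δ : ℝ, 0 < δ →
      Tendsto (fun N : ℕ => Real.sqrt N *
          ⨆ t : (Set.Icc (-δ⁻¹) (-δ) ∪ Set.Icc δ δ⁻¹ : Set ℝ),
            ‖∫ ω, Complex.exp (Complex.I * Complex.ofReal ((t : ℝ) * Z N ω)) ∂P‖)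
        atTop (nhds 0))
    {k : ℝ → ℂ} (hk : Continuous k) (hks : HasCompactSupport k) :
    LocalLimit P Z m σ (expTransform k) (2 * Real.pi * k 0) := by
  obtain ⟨δ₀, hδ₀, c₀, hc₀, d₀, hd₀, b, hb, hφ⟩ := hA1
  obtain ⟨M, hM⟩ := hks.exists_bound_of_continuous hk
  obtain ⟨R, hR⟩ := hks.isCompact.isBounded.subset_closedBall (0 : ℝ)
  set L := max R 1
  have hL1 : 1 ≤ L := le_max_right _ _
  have hL0 : 0 < L := by linarith
  have hL : ∀ t, L < |t| → k t = 0 := fun t ht => by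
    by_contra h
    have := hR (subset_tsupport k h)
    rw [mem_closedBall_zero_iff, Real.norm_eq_abs] at this
    exact absurd (this.trans (le_max_left R 1)) (not_le.2 ht)
  set δ := min δ₀ L⁻¹
  have hδ : 0 < δ := lt_min hδ₀.1 (by positivity)
  have hLδ : L ≤ δ⁻¹ := by
    rw [le_inv_comm₀ hL0 hδ]
    exact min_le_right _ _
  have hkint : Integrable k := hk.integrable_of_hasCompactSupport hks
  set ψ : ℕ → ℝ → ℂ := fun N s =>
    ∫ ω, Complex.exp (Complex.I * Complex.ofReal (s * ((Z N ω - m * N) / Real.sqrt N))) ∂P with hψ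
  have hψφ (N : ℕ) (s u : ℝ) :
      ∫ ω, Complex.exp (Complex.I * Complex.ofReal (s / Real.sqrt N * (Z N ω - u))) ∂P =
      Complex.exp (Complex.I * Complex.ofReal (-(s * ((u - m * N) / Real.sqrt N)))) * ψ N s := by
    rw [integral_exp_I_sub P (Z N) (s / Real.sqrt N) (m * N) u]
    congr 1
    · congr 3
      ring
    · congr with ω
      congr 3
      ring
  have hψnorm (N : ℕ) (s : ℝ) : ‖ψ N s‖ =
      ‖∫ ω, Complex.exp (Complex.I * Complex.ofReal (s / Real.sqrt N * Z N ω)) ∂P‖ := by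
    have h := congrArg norm (hψφ N s 0)
    rw [norm_mul, norm_exp_I_mul_ofReal, one_mul] at h
    rw [← h]
    simp only [sub_zero]
  have hYmeas (N : ℕ) : Measurable fun ω => (Z N ω - m * N) / Real.sqrt N :=
    ((hZmeas N).sub_const _).div_const _
  have hψcont (N : ℕ) : Continuous (ψ N) := continuous_integral_exp_I P (hYmeas N)
  set γ : ℝ → ℂ := fun s => Complex.exp (-((σ ^ 2 / 2 : ℝ) : ℂ) * (s : ℂ) ^ 2) with hγ
  have hγint : Integrable γ :=
    integrable_cexp_neg_mul_sq (by rw [Complex.ofReal_re]; positivity)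
  have herr := tendsto_integral_norm_sub_of_gaussian_bound hk hL0.le hL hM hψcont hγint
    (fun s => tendsto_integral_exp_I_of_clt P hYmeas hv hCLT s) (δ₀ := δ₀) hc₀.le hd₀ hb
    (hA2 δ hδ) (fun N hN s hs => ?_) (fun N hN s hs hs' => ?_)
  rotate_left
  · have hN' : 0 < Real.sqrt N := Real.sqrt_pos.2 (by exact_mod_cast hN)
    rw [hψnorm]
    refine (hφ N _ (abs_le.1 ?_)).trans_eq ?_
    · rwa [abs_div, abs_of_pos hN', div_le_iff₀ hN']
    · rw [div_pow, Real.sq_sqrt (Nat.cast_nonneg N)]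
      have : (N : ℝ) ≠ 0 := by positivity
      congr 3
      field_simp
  · have hN' : 0 < Real.sqrt N := Real.sqrt_pos.2 (by exact_mod_cast hN)
    rw [hψnorm]
    have h1 : δ ≤ |s / Real.sqrt N| := by
      rw [abs_div, abs_of_pos hN', le_div_iff₀ hN']
      exact (mul_le_mul_of_nonneg_right (min_le_left _ _) hN'.le).trans hs
    have h2 : |s / Real.sqrt N| ≤ δ⁻¹ := by
      rw [abs_div, abs_of_pos hN', div_le_iff₀ hN']
      exact hs'.trans (mul_le_mul_of_nonneg_right hLδ hN'.le)
    have hmem : s / Real.sqrt N ∈ (Set.Icc (-δ⁻¹) (-δ) ∪ Set.Icc δ δ⁻¹ : Set ℝ) := by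
      rcases le_total 0 (s / Real.sqrt N) with h | h
      · rw [abs_of_nonneg h] at h1 h2
        exact Or.inr ⟨h1, h2⟩
      · rw [abs_of_nonpos h] at h1 h2
        exact Or.inl ⟨by linarith, by linarith⟩
    exact le_ciSup (f := fun t : (Set.Icc (-δ⁻¹) (-δ) ∪ Set.Icc δ δ⁻¹ : Set ℝ) =>
      ‖∫ ω, Complex.exp (Complex.I * Complex.ofReal ((t : ℝ) * Z N ω)) ∂P‖)
      ⟨1, by rintro _ ⟨t, rfl⟩; exact norm_integral_exp_I_le_one P _⟩ ⟨_, hmem⟩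
  intro ε hε
  have hpi := Real.pi_pos
  have hA : 0 < σ * Real.sqrt (2 * Real.pi) := by positivity
  filter_upwards [herr.eventually_le_const (show 0 < ε / (σ * Real.sqrt (2 * Real.pi)) by
    positivity), eventually_gt_atTop 0] with N hN hN0 u
  have hN' : 0 < Real.sqrt N := Real.sqrt_pos.2 (by exact_mod_cast hN0)
  set w := (u - m * N) / Real.sqrt N with hw
  have hchange : (Real.sqrt N : ℂ) * ∫ ω, expTransform k (Z N ω - u) ∂P =
      ∫ s, k (s / Real.sqrt N) *
        (Complex.exp (Complex.I * Complex.ofReal (-(s * w))) * ψ N s) := by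
    have h := Measure.integral_comp_div (fun t => k t *
      ∫ ω, Complex.exp (Complex.I * Complex.ofReal (t * (Z N ω - u))) ∂P) (Real.sqrt N)
    rw [integral_expTransform_sub P (hZmeas N) hkint, ← Complex.real_smul, ← abs_of_pos hN', ← h,
      abs_of_pos hN']
    simp_rw [hψφ]
    rfl
  have hgauss : ∫ s, k 0 * (Complex.exp (Complex.I * Complex.ofReal (-(s * w))) * γ s) =
      k 0 * ((Real.sqrt (2 * Real.pi) / σ * Real.exp (-w ^ 2 / (2 * σ ^ 2)) : ℝ) : ℂ) := by
    rw [integral_const_mul, integral_exp_I_mul_gaussian hσ]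
  have hoscc : Continuous fun s : ℝ => Complex.exp (Complex.I * Complex.ofReal (-(s * w))) := by
    fun_prop
  have hint1 : Integrable fun s => k (s / Real.sqrt N) * ψ N s :=
    (hkint.comp_div hN'.ne').mul_bdd (c := 1) (hψcont N).aestronglyMeasurable
      (ae_of_all _ fun s => norm_integral_exp_I_le_one P _)
  have hosc {F : ℝ → ℂ} (hF : Integrable F) :
      Integrable fun s => Complex.exp (Complex.I * Complex.ofReal (-(s * w))) * F s :=
    hF.bdd_mul (c := 1) hoscc.aestronglyMeasurable
      (ae_of_all _ fun s => (norm_exp_I_mul_ofReal _).le)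
  have hdiff : ‖(Real.sqrt N : ℂ) * (∫ ω, expTransform k (Z N ω - u) ∂P) -
      k 0 * ((Real.sqrt (2 * Real.pi) / σ * Real.exp (-w ^ 2 / (2 * σ ^ 2)) : ℝ) : ℂ)‖ ≤
      ε / (σ * Real.sqrt (2 * Real.pi)) := by
    rw [hchange, ← hgauss]
    simp_rw [fun s : ℝ => mul_left_comm (k (s / Real.sqrt N)),
      mul_left_comm (k 0)]
    rw [← integral_sub (hosc hint1) (hosc (hγint.const_mul _))]
    refine (norm_integral_le_integral_norm _).trans (le_trans (le_of_eq ?_) hN)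
    congr with s
    rw [← mul_sub, norm_mul, norm_exp_I_mul_ofReal, one_mul]
  have hexp : -w ^ 2 / (2 * σ ^ 2) = -((u - m * N) ^ 2) / (2 * N * σ ^ 2) := by
    have : (N : ℝ) ≠ 0 := by positivity
    rw [hw, div_pow, Real.sq_sqrt (Nat.cast_nonneg N)]
    field_simp
  rw [hexp] at hdiff
  set e := Real.exp (-((u - m * N) ^ 2) / (2 * N * σ ^ 2))
  have hfactor : (σ * Real.sqrt (2 * Real.pi * N)) • (∫ ω, expTransform k (Z N ω - u) ∂P) -
      e • (2 * Real.pi * k 0) = ((σ * Real.sqrt (2 * Real.pi) : ℝ) : ℂ) *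
      ((Real.sqrt N : ℂ) * (∫ ω, expTransform k (Z N ω - u) ∂P) -
        k 0 * ((Real.sqrt (2 * Real.pi) / σ * e : ℝ) : ℂ)) := by
    have hσc : (σ : ℂ) ≠ 0 := by exact_mod_cast hσ.ne'
    have hsq : ((Real.sqrt (2 * Real.pi) : ℝ) : ℂ) * ((Real.sqrt (2 * Real.pi) : ℝ) : ℂ) =
        2 * Real.pi := by
      rw [← Complex.ofReal_mul, Real.mul_self_sqrt (by positivity)]
      push_cast
      ring
    rw [Real.sqrt_mul (by positivity), Complex.real_smul, Complex.real_smul, ← hsq]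
    push_cast
    field_simp
  rw [hfactor, norm_mul, Complex.norm_real, Real.norm_of_nonneg hA.le]
  calc _ ≤ σ * Real.sqrt (2 * Real.pi) * (ε / (σ * Real.sqrt (2 * Real.pi))) := by gcongr
    _ = ε := mul_div_cancel₀ _ hA.ne'

/-- The local limit theorem passes from band-limited functions to continuous compactly
supported functions. -/
lemma localLimit_of_continuous {Ω : Type*} [MeasurableSpace Ω] (P : Measure Ω)
    [IsProbabilityMeasure P] (Z : ℕ → Ω → ℝ) (hZmeas : ∀ N, Measurable (Z N))
    (m σ : ℝ) (hσ : 0 < σ)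
    (hband : ∀ k : ℝ → ℂ, Continuous k → HasCompactSupport k →
      LocalLimit P Z m σ (expTransform k) (2 * Real.pi * k 0))
    {g : ℝ → ℝ} (hg : Continuous g) (hgs : HasCompactSupport g) :
    LocalLimit P Z m σ g (∫ x, g x) := by
  intro ε hε
  have hpi := Real.pi_pos
  have hε' : 0 < ε / (4 * Real.pi + 3) := by positivity
  obtain ⟨k, hk, hks, hk0, hgk⟩ := exists_expTransform_approx hg hgs hε'
  have hsinc := hband (fun t => (triangle t : ℂ))
    (Complex.continuous_ofReal.comp continuous_triangle)
    (hasCompactSupport_triangle.comp_left Complex.ofReal_zero) 1 one_pos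
  filter_upwards [hband k hk hks _ hε', hsinc] with N h1 h2 u
  set A := σ * Real.sqrt (2 * Real.pi * N) with hA
  have hA0 : 0 ≤ A := by positivity
  have hS (u : ℝ) : A * ∫ ω, Real.sinc ((Z N ω - u) / 2) ^ 2 ∂P ≤ 2 * Real.pi + 1 := by
    have h3 := h2 u
    simp_rw [expTransform_triangle] at h3
    rw [integral_complex_ofReal, triangle_zero, Complex.real_smul, Complex.real_smul,
      Complex.ofReal_one, mul_one, ← Complex.ofReal_mul, ← Complex.ofReal_ofNat,
      ← Complex.ofReal_mul, ← Complex.ofReal_mul, ← Complex.ofReal_sub, Complex.norm_real] at h3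
    have h4 := (le_abs_self _).trans h3
    have h5 : Real.exp (-((u - m * N) ^ 2) / (2 * N * σ ^ 2)) ≤ 1 := by
      rw [Real.exp_le_one_iff]
      exact div_nonpos_of_nonpos_of_nonneg (neg_nonpos.2 (sq_nonneg _)) (by positivity)
    have h6 := mul_le_mul_of_nonneg_right h5 (by positivity : 0 ≤ 2 * Real.pi)
    linarith
  have hsincint (a : ℝ) : Integrable (fun ω => Real.sinc ((Z N ω - a) / 2) ^ 2) P := by
    have hm := hZmeas N
    have hs := Real.measurable_sinc
    refine Integrable.of_bound (by fun_prop : Measurable _).aestronglyMeasurable 1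
      (ae_of_all _ fun ω => ?_)
    rw [Real.norm_of_nonneg (sq_nonneg _), sq_le_one_iff_abs_le_one]
    exact Real.abs_sinc_le_one _
  have hsincint' (a : ℝ) : Integrable (fun ω => Real.sinc ((Z N ω - a + Real.pi) / 2) ^ 2) P := by
    have := hsincint (a - Real.pi)
    simpa only [sub_sub_eq_add_sub, sub_add_eq_add_sub] using this
  have hshift : ∫ ω, Real.sinc ((Z N ω - u + Real.pi) / 2) ^ 2 ∂P =
      ∫ ω, Real.sinc ((Z N ω - (u - Real.pi)) / 2) ^ 2 ∂P := by
    congr with ω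
    rw [sub_sub_eq_add_sub, sub_add_eq_add_sub]
  have hgint : Integrable (fun ω => g (Z N ω - u)) P := by
    obtain ⟨M, hM⟩ := hgs.exists_bound_of_continuous hg
    exact Integrable.of_bound
      (hg.measurable.comp ((hZmeas N).sub_const u)).aestronglyMeasurable M
      (ae_of_all _ fun ω => hM _)
  have hgint' : Integrable (fun ω => (g (Z N ω - u) : ℂ)) P := hgint.ofReal
  have hkint := hk.integrable_of_hasCompactSupport hks (μ := volume)
  have hkint' : Integrable (fun ω => expTransform k (Z N ω - u)) P := by
    refine Integrable.of_bound ((continuous_expTransform hkint).measurable.comp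
      ((hZmeas N).sub_const u)).aestronglyMeasurable (∫ t, ‖k t‖) (ae_of_all _ fun ω => ?_)
    refine norm_integral_le_of_norm_le hkint.norm (ae_of_all _ fun t => ?_)
    rw [norm_mul, norm_exp_I_mul_ofReal, mul_one]
  have hdiff : A * ‖((∫ ω, g (Z N ω - u) ∂P : ℝ) : ℂ) - ∫ ω, expTransform k (Z N ω - u) ∂P‖ ≤
      ε / (4 * Real.pi + 3) * (4 * Real.pi + 2) := by
    have h3 : ‖((∫ ω, g (Z N ω - u) ∂P : ℝ) : ℂ) - ∫ ω, expTransform k (Z N ω - u) ∂P‖ ≤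
        ε / (4 * Real.pi + 3) * ((∫ ω, Real.sinc ((Z N ω - u) / 2) ^ 2 ∂P) +
          ∫ ω, Real.sinc ((Z N ω - (u - Real.pi)) / 2) ^ 2 ∂P) := by
      rw [← hshift, ← integral_add (hsincint u) (hsincint' u), ← integral_const_mul,
        ← integral_complex_ofReal, ← integral_sub hgint' hkint']
      exact norm_integral_le_of_norm_le (((hsincint u).add (hsincint' u)).const_mul _)
        (ae_of_all _ fun ω => hgk _)
    have h4 := mul_le_mul_of_nonneg_left h3 hA0
    have h5 := mul_le_mul_of_nonneg_left (add_le_add (hS u) (hS (u - Real.pi))) hε'.le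
    linarith
  have h1u := h1 u
  rw [hk0] at h1u
  set e := Real.exp (-((u - m * N) ^ 2) / (2 * N * σ ^ 2))
  have hcast : ‖A • (∫ ω, g (Z N ω - u) ∂P) - e • ∫ x, g x‖ =
      ‖A • ((∫ ω, g (Z N ω - u) ∂P : ℝ) : ℂ) - e • ((∫ x, g x : ℝ) : ℂ)‖ := by
    rw [Complex.real_smul, Complex.real_smul, ← Complex.ofReal_mul, ← Complex.ofReal_mul,
      ← Complex.ofReal_sub, Complex.norm_real, smul_eq_mul, smul_eq_mul]
  rw [hcast]
  calc _ = ‖A • (((∫ ω, g (Z N ω - u) ∂P : ℝ) : ℂ) - ∫ ω, expTransform k (Z N ω - u) ∂P) +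
        (A • (∫ ω, expTransform k (Z N ω - u) ∂P) - e • ((∫ x, g x : ℝ) : ℂ))‖ := by
        rw [smul_sub, sub_add_sub_cancel]
    _ ≤ ε / (4 * Real.pi + 3) * (4 * Real.pi + 2) + ε / (4 * Real.pi + 3) := by
        refine (norm_add_le _ _).trans (add_le_add ?_ h1u)
        rwa [norm_smul, Real.norm_of_nonneg hA0]
    _ = ε := by field_simp; ring

/-- The local limit theorem passes to functions squeezed between continuous compactly supported
ones. -/
lemma localLimit_of_forall_squeeze {Ω : Type*} [MeasurableSpace Ω] (P : Measure Ω)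
    [IsProbabilityMeasure P] (Z : ℕ → Ω → ℝ) (hZmeas : ∀ N, Measurable (Z N))
    (m σ : ℝ) (hσ : 0 < σ)
    (hcont : ∀ f : ℝ → ℝ, Continuous f → HasCompactSupport f →
      LocalLimit P Z m σ f (∫ x, f x))
    {g : ℝ → ℝ} (hg : Measurable g) {c : ℝ}
    (hsq : ∀ ε : ℝ, 0 < ε → ∃ f h : ℝ → ℝ, (Continuous f ∧ HasCompactSupport f) ∧
      (Continuous h ∧ HasCompactSupport h) ∧ f ≤ g ∧ g ≤ h ∧
      c - ε ≤ ∫ x, f x ∧ ∫ x, h x ≤ c + ε) :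
    LocalLimit P Z m σ g c := by
  intro ε hε
  obtain ⟨f, h, ⟨hf, hfs⟩, ⟨hh, hhs⟩, hfg, hgh, hfc, hhc⟩ := hsq (ε / 2) (by positivity)
  filter_upwards [hcont f hf hfs (ε / 2) (by positivity), hcont h hh hhs (ε / 2) (by positivity)]
    with N h1 h2 u
  have hint {q : ℝ → ℝ} (hq : Continuous q) (hqs : HasCompactSupport q) :
      Integrable (fun ω => q (Z N ω - u)) P := by
    obtain ⟨M, hM⟩ := hqs.exists_bound_of_continuous hq
    exact Integrable.of_bound
      (hq.measurable.comp ((hZmeas N).sub_const u)).aestronglyMeasurable M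
      (ae_of_all _ fun ω => hM _)
  have hgint : Integrable (fun ω => g (Z N ω - u)) P :=
    integrable_of_le_of_le (hg.comp ((hZmeas N).sub_const u)).aestronglyMeasurable
      (ae_of_all _ fun ω => hfg _) (ae_of_all _ fun ω => hgh _) (hint hf hfs) (hint hh hhs)
  have h3 := integral_mono (hint hf hfs) hgint fun ω => hfg (Z N ω - u)
  have h4 := integral_mono hgint (hint hh hhs) fun ω => hgh (Z N ω - u)
  have h1u := h1 u
  have h2u := h2 u
  have hA0 : 0 ≤ σ * Real.sqrt (2 * Real.pi * N) := by positivity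
  have he1 : Real.exp (-((u - m * N) ^ 2) / (2 * N * σ ^ 2)) ≤ 1 := by
    rw [Real.exp_le_one_iff]
    exact div_nonpos_of_nonpos_of_nonneg (neg_nonpos.2 (sq_nonneg _)) (by positivity)
  have he0 := Real.exp_nonneg (-((u - m * N) ^ 2) / (2 * N * σ ^ 2))
  simp only [smul_eq_mul, Real.norm_eq_abs, abs_le] at h1u h2u ⊢
  have h5 := mul_le_mul_of_nonneg_left h3 hA0
  have h6 := mul_le_mul_of_nonneg_left h4 hA0
  have h7 := mul_le_mul_of_nonneg_left hfc he0
  have h8 := mul_le_mul_of_nonneg_left hhc he0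
  have h9 := mul_le_mul_of_nonneg_right he1 (half_pos hε).le
  rw [mul_sub] at h7
  rw [mul_add] at h8
  constructor <;> linarith

/-- A continuous trapezoid equal to one on `[a, b]` and to zero outside `[a - η, b + η]`. -/
noncomputable def trapezoid (a b η x : ℝ) : ℝ :=
  max 0 (min 1 (min ((x - a) / η + 1) ((b - x) / η + 1)))

lemma continuous_trapezoid (a b η : ℝ) : Continuous (trapezoid a b η) := by
  unfold trapezoid; fun_prop

lemma indicator_le_trapezoid (a b : ℝ) {η : ℝ} (hη : 0 < η) :
    (Set.Icc a b).indicator (fun _ => (1 : ℝ)) ≤ trapezoid a b η := by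
  refine Set.indicator_le' (fun x hx => ?_) fun _ _ => le_max_left _ _
  have h1 : 0 ≤ (x - a) / η := div_nonneg (by linarith [hx.1]) hη.le
  have h2 : 0 ≤ (b - x) / η := div_nonneg (by linarith [hx.2]) hη.le
  exact le_max_of_le_right (le_min le_rfl (le_min (by linarith) (by linarith)))

lemma trapezoid_eq_zero (a b : ℝ) {η : ℝ} (hη : 0 < η) {x : ℝ}
    (hx : x ∉ Set.Icc (a - η) (b + η)) : trapezoid a b η x = 0 := by
  refine max_eq_left (min_le_of_right_le ?_)
  rw [Set.mem_Icc, not_and_or, not_le, not_le] at hx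
  rcases hx with hx | hx
  · refine min_le_of_left_le ?_
    rw [← le_sub_iff_add_le, div_le_iff₀ hη]
    linarith
  · refine min_le_of_right_le ?_
    rw [← le_sub_iff_add_le, div_le_iff₀ hη]
    linarith

lemma trapezoid_le_indicator (a b : ℝ) {η : ℝ} (hη : 0 < η) :
    trapezoid a b η ≤ (Set.Icc (a - η) (b + η)).indicator (fun _ => (1 : ℝ)) :=
  fun _ => Set.le_indicator_apply
    (fun _ => max_le zero_le_one (min_le_left _ _))
    (fun hx => (trapezoid_eq_zero a b hη hx).le)

lemma hasCompactSupport_trapezoid (a b : ℝ) {η : ℝ} (hη : 0 < η) :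
    HasCompactSupport (trapezoid a b η) :=
  HasCompactSupport.intro isCompact_Icc fun _ hx => trapezoid_eq_zero a b hη hx

lemma integrable_trapezoid (a b : ℝ) {η : ℝ} (hη : 0 < η) : Integrable (trapezoid a b η) :=
  (continuous_trapezoid a b η).integrable_of_hasCompactSupport (hasCompactSupport_trapezoid a b hη)

lemma integrable_indicator_Icc (a b : ℝ) :
    Integrable ((Set.Icc a b).indicator fun _ => (1 : ℝ)) :=
  (integrable_indicator_iff measurableSet_Icc).2 (integrableOn_const measure_Icc_lt_top.ne)

lemma integral_indicator_Icc (a b : ℝ) :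
    ∫ x, (Set.Icc a b).indicator (fun _ => (1 : ℝ)) x = max (b - a) 0 := by
  rw [integral_indicator measurableSet_Icc, setIntegral_const, Real.volume_real_Icc, smul_eq_mul,
    mul_one]

lemma le_integral_trapezoid (a b : ℝ) {η : ℝ} (hη : 0 < η) :
    b - a ≤ ∫ x, trapezoid a b η x := by
  have h := integral_mono (integrable_indicator_Icc a b) (integrable_trapezoid a b hη)
    (indicator_le_trapezoid a b hη)
  rw [integral_indicator_Icc] at h
  exact (le_max_left _ _).trans h

lemma integral_trapezoid_le {a b η : ℝ} (hη : 0 < η) (hab : a ≤ b) :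
    ∫ x, trapezoid a b η x ≤ b - a + 2 * η := by
  have h := integral_mono (integrable_trapezoid a b hη)
    (integrable_indicator_Icc (a - η) (b + η)) (trapezoid_le_indicator a b hη)
  rw [integral_indicator_Icc, max_eq_left (by linarith)] at h
  linarith

/-- general LCLT, non-lattice case: if `N^{−1/2}(Z_N − mN)` satisfies the CLT
with variance `σ² > 0`, Assumption (A1) (Gaussian-type bound on the characteristic functions
near `0` up to an `o(N^{−1/2})` error) and Assumption (A2) (`√N sup_{J_δ} |φ_N| → 0` for every
`δ > 0`) hold, then for any continuous compactly supported `g` (or an indicator of a bounded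
closed interval),
`sup_u |σ√(2πN) E[g(Z_N − u)] − e^{−(u−mN)²/(2Nσ²)} ∫ g| → 0`. -/
theorem statement7
    {Ω : Type*} [MeasurableSpace Ω] (P : Measure Ω) [IsProbabilityMeasure P]
    (Z : ℕ → Ω → ℝ) (hZmeas : ∀ N, Measurable (Z N))
    (m σ : ℝ) (hσ : 0 < σ)
    (hCLT : ∀ f : BoundedContinuousFunction ℝ ℝ,
      Tendsto (fun N : ℕ => ∫ ω, f ((Z N ω - m * N) / Real.sqrt N) ∂P) atTop
        (nhds (∫ x, f x ∂(gaussianReal 0 ⟨σ ^ 2, sq_nonneg σ⟩))))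
    (hA1 : ∃ δ₀ ∈ Set.Ioo (0 : ℝ) 1, ∃ c₀ > (0 : ℝ), ∃ d₀ > (0 : ℝ), ∃ b : ℕ → ℝ,
      Tendsto (fun N : ℕ => Real.sqrt N * b N) atTop (nhds 0) ∧
      ∀ N : ℕ, ∀ t ∈ Set.Icc (-δ₀) δ₀,
        ‖∫ ω, Complex.exp (Complex.I * Complex.ofReal (t * Z N ω)) ∂P‖
          ≤ c₀ * Real.exp (-d₀ * N * t ^ 2) + b N)
    (hA2 : ∀ δ : ℝ, 0 < δ →
      Tendsto (fun N : ℕ => Real.sqrt N *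
          ⨆ t : (Set.Icc (-δ⁻¹) (-δ) ∪ Set.Icc δ δ⁻¹ : Set ℝ),
            ‖∫ ω, Complex.exp (Complex.I * Complex.ofReal ((t : ℝ) * Z N ω)) ∂P‖)
        atTop (nhds 0))
    (g : ℝ → ℝ)
    (hg : (Continuous g ∧ HasCompactSupport g) ∨
      ∃ a b : ℝ, a ≤ b ∧ g = (Set.Icc a b).indicator (fun _ => (1 : ℝ))) :
    ∀ ε : ℝ, 0 < ε → ∀ᶠ N : ℕ in atTop, ∀ u : ℝ,
      |σ * Real.sqrt (2 * Real.pi * N) * (∫ ω, g (Z N ω - u) ∂P)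
        - Real.exp (-((u - m * N) ^ 2) / (2 * N * σ ^ 2)) * ∫ x, g x| ≤ ε := by
  have hcont (f : ℝ → ℝ) (hf : Continuous f) (hfs : HasCompactSupport f) :
      LocalLimit P Z m σ f (∫ x, f x) :=
    localLimit_of_continuous P Z hZmeas m σ hσ
      (fun _ hk hks => localLimit_expTransform P Z hZmeas m σ hσ rfl hCLT hA1 hA2 hk hks) hf hfs
  rcases hg with ⟨hg, hgs⟩ | ⟨a, b, hab, rfl⟩
  · exact hcont g hg hgs
  · refine localLimit_of_forall_squeeze P Z hZmeas m σ hσ hcont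
      (measurable_const.indicator measurableSet_Icc) fun ε hε => ?_
    have hη : 0 < ε / 2 := by positivity
    refine ⟨trapezoid (a + ε / 2) (b - ε / 2) (ε / 2), trapezoid a b (ε / 2),
      ⟨continuous_trapezoid _ _ _, hasCompactSupport_trapezoid _ _ hη⟩,
      ⟨continuous_trapezoid _ _ _, hasCompactSupport_trapezoid _ _ hη⟩, ?_,
      indicator_le_trapezoid a b hη, ?_, ?_⟩
    · simpa using trapezoid_le_indicator (a + ε / 2) (b - ε / 2) hη
    · rw [integral_indicator_Icc, max_eq_left (by linarith)]
      linarith [le_integral_trapezoid (a + ε / 2) (b - ε / 2) hη]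
    · rw [integral_indicator_Icc, max_eq_left (by linarith)]
      linarith [integral_trapezoid_le hη hab]
end

section
/- Let n₁ < n₂ < ... < n_m be positive integers and r ∈ ℕ with n_{s+1} − n_s > 2r for all s = 1,...,m−1, and let f₁,...,f_m : X^k → [−1,1] be measurable. Then | E[ ∏_{s=1}^m f_s(Y_{n_s,r}) ] − ∏_{s=1}^m E[ f_s(Y_{n_s,r}) ] | ≤ 4 Σ_{j=1}^{k} Σ_{s=1}^{m−1} φ( j(n_{s+1} − n_s − 2r) ). -/
open MeasureTheory ProbabilityTheory Filter
open scoped ENNReal NNReal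

/-- The φ-dependence coefficient between two sub-σ-algebras. -/
noncomputable def phiDep {Ω : Type*} [MeasurableSpace Ω] (P : Measure Ω)
    (𝔊 ℌ : MeasurableSpace Ω) : ℝ :=
  sSup {x : ℝ | ∃ A B : Set Ω, MeasurableSet[𝔊] A ∧ MeasurableSet[ℌ] B ∧ 0 < P A ∧
    x = |(P (A ∩ B) / P A).toReal - (P B).toReal|}

/-- The φ-mixing coefficients of a family of σ-algebras `F n m`. -/
noncomputable def mixPhi {Ω : Type*} [MeasurableSpace Ω] (P : Measure Ω)
    (F : ℤ → ℤ → MeasurableSpace Ω) (n : ℕ) : ℝ :=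
  ⨆ k : ℤ, phiDep P (⨆ j : {j : ℤ // j ≤ k}, F j.1 k)
    (⨆ m : {m : ℤ // k + (n : ℤ) ≤ m}, F (k + (n : ℤ)) m.1)

/-- Two finite measures of equal mass that differ by at most `c` on the superlevel sets of a
function with values in `[-1, 1]` give integrals differing by at most `2 * c`. -/
theorem abs_integral_sub_integral_le_of_superlevel {Ω : Type*} [MeasurableSpace Ω]
    {μ ν : Measure Ω} [IsFiniteMeasure μ] [IsFiniteMeasure ν] {g : Ω → ℝ} (hg : Measurable g)
    (hb : ∀ ω, g ω ∈ Set.Icc (-1 : ℝ) 1) {c : ℝ}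
    (hmass : μ.real Set.univ = ν.real Set.univ)
    (hc : ∀ t, |μ.real {ω | t ≤ g ω} - ν.real {ω | t ≤ g ω}| ≤ c) :
    |∫ ω, g ω ∂μ - ∫ ω, g ω ∂ν| ≤ 2 * c := by
  have hgint : ∀ (ρ : Measure Ω) [IsFiniteMeasure ρ], Integrable g ρ := fun ρ _ =>
    Integrable.of_bound hg.aestronglyMeasurable 1
      (ae_of_all _ fun ω => abs_le.2 ⟨(hb ω).1, (hb ω).2⟩)
  have hanti : ∀ (ρ : Measure Ω) [IsFiniteMeasure ρ],
      IntegrableOn (fun t : ℝ => ρ.real {ω | t ≤ g ω + 1}) (Set.Ioc 0 2) volume := by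
    intro ρ _
    have h : Antitone fun t : ℝ => ρ.real {ω | t ≤ g ω + 1} := fun s t hst =>
      measureReal_mono fun ω (hω : t ≤ g ω + 1) => hst.trans hω
    exact (h.antitoneOn _).integrableOn_isCompact isCompact_Icc |>.mono_set Set.Ioc_subset_Icc_self
  have hlayer : ∀ (ρ : Measure Ω) [IsFiniteMeasure ρ], ∫ ω, g ω ∂ρ + ρ.real Set.univ
      = ∫ t in Set.Ioc (0 : ℝ) 2, ρ.real {ω | t ≤ g ω + 1} := by
    intro ρ _
    have hi : Integrable (fun ω => g ω + 1) ρ := (hgint ρ).add (integrable_const 1)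
    rw [← hi.integral_eq_integral_Ioc_meas_le
      (ae_of_all _ fun ω => by simpa using neg_le_iff_add_nonneg.1 (hb ω).1)
      (ae_of_all _ fun ω => by have := (hb ω).2; linarith),
      integral_add (hgint ρ) (integrable_const 1)]
    simp
  have key : ∫ ω, g ω ∂μ - ∫ ω, g ω ∂ν = ∫ t in Set.Ioc (0 : ℝ) 2,
      (μ.real {ω | t ≤ g ω + 1} - ν.real {ω | t ≤ g ω + 1}) := by
    rw [integral_sub (hanti μ) (hanti ν), ← hlayer μ, ← hlayer ν, hmass]
    ring
  rw [key, ← Real.norm_eq_abs]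
  refine (norm_setIntegral_le_of_norm_le_const (C := c) (by simp) fun t _ => ?_).trans ?_
  · have h : {ω | t ≤ g ω + 1} = {ω | t - 1 ≤ g ω} := by
      ext ω; simp
    rw [h]
    exact hc _
  · simp [mul_comm]

/-- Hoeffding's covariance bound for functions with values in `[-1, 1]` whose superlevel sets
have covariance at most `c`. -/
theorem abs_covariance_le_of_superlevel {Ω : Type*} [MeasurableSpace Ω]
    {P : Measure Ω} [IsProbabilityMeasure P] {g h : Ω → ℝ} (hg : Measurable g) (hh : Measurable h)
    (hgb : ∀ ω, g ω ∈ Set.Icc (-1 : ℝ) 1) (hhb : ∀ ω, h ω ∈ Set.Icc (-1 : ℝ) 1) {c : ℝ}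
    (hc : ∀ s t, |P.real ({ω | s ≤ g ω} ∩ {ω | t ≤ h ω})
      - P.real {ω | s ≤ g ω} * P.real {ω | t ≤ h ω}| ≤ c) :
    |∫ ω, g ω * h ω ∂P - (∫ ω, g ω ∂P) * ∫ ω, h ω ∂P| ≤ 4 * c := by
  have hgi : Integrable g P := Integrable.of_bound hg.aestronglyMeasurable 1
      (ae_of_all _ fun ω => abs_le.2 ⟨(hgb ω).1, (hgb ω).2⟩)
  have hhi : Integrable h P := Integrable.of_bound hh.aestronglyMeasurable 1
      (ae_of_all _ fun ω => abs_le.2 ⟨(hhb ω).1, (hhb ω).2⟩)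
  have hghi : Integrable (fun ω => h ω * g ω) P := hgi.bdd_mul (c := 1)
    hh.aestronglyMeasurable (ae_of_all _ fun ω => abs_le.2 ⟨(hhb ω).1, (hhb ω).2⟩)
  have hset : ∀ s, |∫ ω in {ω | s ≤ g ω}, h ω ∂P - P.real {ω | s ≤ g ω} * ∫ ω, h ω ∂P|
      ≤ 2 * c := by
    intro s
    have := abs_integral_sub_integral_le_of_superlevel (μ := P.restrict {ω | s ≤ g ω})
      (ν := (P {ω | s ≤ g ω}).toNNReal • P) hh hhb (c := c) (by simp [Measure.real]) (fun t => by
        have ht : MeasurableSet {ω | t ≤ h ω} := measurableSet_le measurable_const hh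
        have := hc s t
        rw [Set.inter_comm, ← measureReal_restrict_apply ht] at this
        simpa [Measure.real] using this)
    rw [integral_smul_nnreal_measure] at this
    exact this
  have hw : Measurable fun ω => ENNReal.ofReal (h ω + 1) := (hh.add_const 1).ennreal_ofReal
  have hnn : ∀ ω, 0 ≤ h ω + 1 := fun ω => by have := (hhb ω).1; linarith
  have hEnn : 0 ≤ ∫ ω, h ω ∂P + 1 := by
    have : ∫ ω, (h ω + 1) ∂P = ∫ ω, h ω ∂P + 1 := by
      rw [integral_add hhi (integrable_const 1)]; simp
    rw [← this]
    exact integral_nonneg hnn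
  have hfin : IsFiniteMeasure (P.withDensity fun ω => ENNReal.ofReal (h ω + 1)) :=
    isFiniteMeasure_withDensity_ofReal (hhi.add (integrable_const 1)).2
  have hreal : ∀ A, MeasurableSet A →
      (P.withDensity fun ω => ENNReal.ofReal (h ω + 1)).real A = ∫ ω in A, h ω ∂P + P.real A := by
    intro A hA
    have hi : Integrable (fun ω => h ω + 1) P := hhi.add (integrable_const 1)
    rw [Measure.real, withDensity_apply _ hA,
      ← ofReal_integral_eq_lintegral_ofReal hi.integrableOn (ae_of_all _ hnn),
      ENNReal.toReal_ofReal (integral_nonneg hnn),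
      integral_add hhi.integrableOn (integrable_const 1).integrableOn]
    simp
  let e : ℝ≥0 := ⟨∫ ω, h ω ∂P + 1, hEnn⟩
  have he : (e : ℝ) = ∫ ω, h ω ∂P + 1 := rfl
  have := abs_integral_sub_integral_le_of_superlevel
    (μ := P.withDensity fun ω => ENNReal.ofReal (h ω + 1))
    (ν := e • P) hg hgb (c := 2 * c)
    (by rw [hreal _ MeasurableSet.univ]; simp [he]) (fun s => by
      rw [hreal _ (measurableSet_le measurable_const hg)]
      convert hset s using 2
      simp only [measureReal_nnreal_smul_apply, he]
      ring)
  rw [integral_withDensity_eq_integral_toReal_smul hw (ae_of_all _ fun _ => ENNReal.ofReal_lt_top),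
    integral_smul_nnreal_measure] at this
  simp only [ENNReal.toReal_ofReal (hnn _), smul_eq_mul, NNReal.smul_def, he,
    add_mul, one_mul] at this
  rw [integral_add hghi hgi] at this
  simp only [mul_comm (g _)]
  convert this using 1
  · congr 1; ring
  · ring

/-- `C` bounds the covariance of all `[-1, 1]`-valued functions of `U` and of `V`. -/
def IsCovBound {Ω α β : Type*} [MeasurableSpace Ω] [MeasurableSpace α] [MeasurableSpace β]
    (P : Measure Ω) (U : Ω → α) (V : Ω → β) (C : ℝ) : Prop :=
  ∀ (a : α → ℝ) (b : β → ℝ), Measurable a → Measurable b →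
    (∀ x, a x ∈ Set.Icc (-1 : ℝ) 1) → (∀ x, b x ∈ Set.Icc (-1 : ℝ) 1) →
    |∫ ω, a (U ω) * b (V ω) ∂P - (∫ ω, a (U ω) ∂P) * ∫ ω, b (V ω) ∂P| ≤ C

theorem ProbabilityTheory.IndepFun.integral_eq_integral_integral {Ω α β : Type*}
    [MeasurableSpace Ω] [MeasurableSpace α] [MeasurableSpace β] {P : Measure Ω}
    [IsProbabilityMeasure P] {Z : Ω → α} {W : Ω → β} (hZW : IndepFun Z W P)
    (hZ : Measurable Z) (hW : Measurable W) {G : α → β → ℝ}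
    (hG : Measurable (Function.uncurry G)) (hb : ∀ x y, |G x y| ≤ 1) :
    ∫ ω, G (Z ω) (W ω) ∂P = ∫ ω', ∫ ω, G (Z ω) (W ω') ∂P ∂P := by
  have : IsProbabilityMeasure (P.map Z) := Measure.isProbabilityMeasure_map hZ.aemeasurable
  have : IsProbabilityMeasure (P.map W) := Measure.isProbabilityMeasure_map hW.aemeasurable
  have hlaw := (indepFun_iff_map_prod_eq_prod_map_map hZ.aemeasurable hW.aemeasurable).1 hZW
  calc ∫ ω, G (Z ω) (W ω) ∂P
      = ∫ z, Function.uncurry G z ∂(P.map fun ω => (Z ω, W ω)) :=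
        (integral_map (hZ.prodMk hW).aemeasurable hG.aestronglyMeasurable).symm
    _ = ∫ y, ∫ x, G x y ∂(P.map Z) ∂(P.map W) := by
        rw [hlaw, integral_prod_symm]
        · rfl
        · exact Integrable.of_bound hG.aestronglyMeasurable 1 (ae_of_all _ fun z => hb z.1 z.2)
    _ = ∫ ω', ∫ x, G x (W ω') ∂(P.map Z) ∂P :=
        integral_map hW.aemeasurable hG.stronglyMeasurable.integral_prod_left.aestronglyMeasurable
    _ = ∫ ω', ∫ ω, G (Z ω) (W ω') ∂P ∂P := by
        refine integral_congr_ae (ae_of_all _ fun ω' => ?_)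
        exact integral_map hZ.aemeasurable
          (hG.comp (measurable_id.prodMk measurable_const)).aestronglyMeasurable

theorem integral_mem_Icc {Ω : Type*} [MeasurableSpace Ω] {P : Measure Ω} [IsProbabilityMeasure P]
    {g : Ω → ℝ} (hb : ∀ ω, g ω ∈ Set.Icc (-1 : ℝ) 1) : ∫ ω, g ω ∂P ∈ Set.Icc (-1 : ℝ) 1 := by
  have := norm_integral_le_of_norm_le_const (μ := P) (f := g) (C := 1)
    (ae_of_all _ fun ω => abs_le.2 ⟨(hb ω).1, (hb ω).2⟩)
  rw [probReal_univ, mul_one] at this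
  exact abs_le.1 this

theorem mul_mem_Icc_neg_one_one {x y : ℝ} (hx : x ∈ Set.Icc (-1 : ℝ) 1)
    (hy : y ∈ Set.Icc (-1 : ℝ) 1) : x * y ∈ Set.Icc (-1 : ℝ) 1 := by
  refine abs_le.1 ?_
  rw [abs_mul]
  exact mul_le_one₀ (abs_le.2 hx) (abs_nonneg _) (abs_le.2 hy)

/-- Covariance bounds add over independent blocks. -/
theorem IsCovBound.prodMk {Ω α β α' β' : Type*} [MeasurableSpace Ω] [MeasurableSpace α]
    [MeasurableSpace β] [MeasurableSpace α'] [MeasurableSpace β'] {P : Measure Ω}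
    [IsProbabilityMeasure P] {U : Ω → α} {V : Ω → β} {U' : Ω → α'} {V' : Ω → β'} {C C' : ℝ}
    (hC : IsCovBound P U V C) (hC' : IsCovBound P U' V' C')
    (hU : Measurable U) (hV : Measurable V) (hU' : Measurable U') (hV' : Measurable V')
    (hind : IndepFun (fun ω => (U ω, V ω)) (fun ω => (U' ω, V' ω)) P) :
    IsCovBound P (fun ω => (U ω, U' ω)) (fun ω => (V ω, V' ω)) (C + C') := by
  intro a b ha hb hab hbb
  have habs : ∀ x, |a x| ≤ 1 := fun x => abs_le.2 (hab x)
  have hbbs : ∀ x, |b x| ≤ 1 := fun x => abs_le.2 (hbb x)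
  have hUind : IndepFun U U' P := hind.comp measurable_fst measurable_fst
  have hVind : IndepFun V V' P := hind.comp measurable_snd measurable_snd
  have eA := hUind.integral_eq_integral_integral hU hU' (G := fun x y => a (x, y)) ha
    fun x y => habs _
  have eB := hVind.integral_eq_integral_integral hV hV' (G := fun x y => b (x, y)) hb
    fun x y => hbbs _
  have hGm : Measurable (Function.uncurry fun (z : α × β) (w : α' × β') =>
      a (z.1, w.1) * b (z.2, w.2)) := by
    refine (ha.comp ?_).mul (hb.comp ?_) <;> fun_prop
  have eAB := hind.integral_eq_integral_integral (hU.prodMk hV) (hU'.prodMk hV') hGm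
    fun x y => abs_le.2 (mul_mem_Icc_neg_one_one (hab _) (hbb _))
  set A : α' → ℝ := fun u => ∫ ω, a (U ω, u) ∂P with hA
  set B : β' → ℝ := fun v => ∫ ω, b (V ω, v) ∂P with hB
  have hAm : Measurable A := by
    have : Measurable (Function.uncurry fun ω u => a (U ω, u)) := by
      refine ha.comp ?_; fun_prop
    exact this.stronglyMeasurable.integral_prod_left.measurable
  have hBm : Measurable B := by
    have : Measurable (Function.uncurry fun ω v => b (V ω, v)) := by
      refine hb.comp ?_; fun_prop
    exact this.stronglyMeasurable.integral_prod_left.measurable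
  have hAb : ∀ x, A x ∈ Set.Icc (-1 : ℝ) 1 := fun x => integral_mem_Icc fun ω => hab _
  have hBb : ∀ x, B x ∈ Set.Icc (-1 : ℝ) 1 := fun x => integral_mem_Icc fun ω => hbb _
  have h' := hC' A B hAm hBm hAb hBb
  have hAB : Integrable (fun ω => A (U' ω) * B (V' ω)) P :=
    Integrable.of_bound ((hAm.comp hU').mul (hBm.comp hV')).aestronglyMeasurable 1
      (ae_of_all _ fun ω => abs_le.2 (mul_mem_Icc_neg_one_one (hAb _) (hBb _)))
  have hI : Integrable (fun ω' => ∫ ω, a (U ω, U' ω') * b (V ω, V' ω') ∂P) P := by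
    refine Integrable.of_bound ?_ 1 (ae_of_all _ fun ω => abs_le.2 (integral_mem_Icc fun _ =>
      mul_mem_Icc_neg_one_one (hab _) (hbb _)))
    have : Measurable (Function.uncurry fun ω ω' => a (U ω, U' ω') * b (V ω, V' ω')) := by
      refine (ha.comp ?_).mul (hb.comp ?_) <;> fun_prop
    exact this.stronglyMeasurable.integral_prod_left.aestronglyMeasurable
  have h : |∫ ω', (∫ ω, a (U ω, U' ω') * b (V ω, V' ω') ∂P) ∂P
      - ∫ ω, A (U' ω) * B (V' ω) ∂P| ≤ C := by
    rw [← integral_sub hI hAB]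
    rw [← Real.norm_eq_abs, ← mul_one C, ← probReal_univ (μ := P)]
    refine norm_integral_le_of_norm_le_const (ae_of_all _ fun ω' => ?_)
    exact hC (fun x => a (x, U' ω')) (fun y => b (y, V' ω'))
      (ha.comp (by fun_prop)) (hb.comp (by fun_prop)) (fun _ => hab _) (fun _ => hbb _)
  rw [eA, eB, eAB]
  calc _ ≤ _ := abs_sub_le _ (∫ ω, A (U' ω) * B (V' ω) ∂P) _
    _ ≤ C + C' := add_le_add h h'

theorem IsCovBound.comp {Ω α β α' β' : Type*} [MeasurableSpace Ω] [MeasurableSpace α]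
    [MeasurableSpace β] [MeasurableSpace α'] [MeasurableSpace β'] {P : Measure Ω}
    {U : Ω → α} {V : Ω → β} {C : ℝ} (hC : IsCovBound P U V C) {p : α → α'} {q : β → β'}
    (hp : Measurable p) (hq : Measurable q) :
    IsCovBound P (fun ω => p (U ω)) (fun ω => q (V ω)) C :=
  fun a b ha hb hab hbb => hC (fun x => a (p x)) (fun y => b (q y)) (ha.comp hp) (hb.comp hq)
    (fun _ => hab _) fun _ => hbb _

theorem measurable_fin_cons {α : Type*} [MeasurableSpace α] (k : ℕ) :
    Measurable fun z : α × (Fin k → α) => (Fin.cons z.1 z.2 : Fin (k + 1) → α) := by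
  refine measurable_pi_iff.2 fun i => ?_
  cases i using Fin.cases with
  | zero => simpa using measurable_fst
  | succ i => simpa using measurable_snd.eval

/-- Covariance bounds add over finitely many independent blocks. -/
theorem IsCovBound.pi {Ω α β : Type*} [MeasurableSpace Ω] [MeasurableSpace α]
    [MeasurableSpace β] {P : Measure Ω} [IsProbabilityMeasure P] {k : ℕ}
    {U : Fin k → Ω → α} {V : Fin k → Ω → β} {C : Fin k → ℝ}
    (hC : ∀ j, IsCovBound P (U j) (V j) (C j))
    (hU : ∀ j, Measurable (U j)) (hV : ∀ j, Measurable (V j))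
    (hind : iIndepFun (fun j ω => (U j ω, V j ω)) P) :
    IsCovBound P (fun ω j => U j ω) (fun ω j => V j ω) (∑ j, C j) := by
  induction k with
  | zero =>
    intro a b _ _ _ _
    have hA : ∀ x y, a x = a y := fun x y => congrArg a (Subsingleton.elim _ _)
    have hB : ∀ x y, b x = b y := fun x y => congrArg b (Subsingleton.elim _ _)
    have hA' : ∀ ω, a (fun j => U j ω) = a Fin.elim0 := fun _ => hA _ _
    have hB' : ∀ ω, b (fun j => V j ω) = b Fin.elim0 := fun _ => hB _ _
    simp [hA', hB']
  | succ k ih =>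
    have htail := ih (fun j => hC j.succ) (fun j => hU j.succ) (fun j => hV j.succ)
      (hind.precomp (Fin.succ_injective k))
    have hsplit : IndepFun (fun ω => (U 0 ω, V 0 ω))
        (fun ω => ((fun j : Fin k => U j.succ ω), fun j : Fin k => V j.succ ω)) P := by
      have h := hind.indepFun_finset {0} (Finset.univ.map (Fin.succEmb k))
        (by simp [Fin.succ_ne_zero]) fun j => (hU j).prodMk (hV j)
      have hmem : ∀ j : Fin k, j.succ ∈ Finset.univ.map (Fin.succEmb k) := fun j => by simp
      refine h.comp (φ := fun x : ({0} : Finset (Fin (k + 1))) → α × β => x ⟨0, by simp⟩)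
        (ψ := fun x : Finset.univ.map (Fin.succEmb k) → α × β =>
          ((fun j : Fin k => (x ⟨j.succ, hmem j⟩).1),
          fun j : Fin k => (x ⟨j.succ, hmem j⟩).2)) (measurable_pi_apply _) ?_
      fun_prop
    have h := ((hC 0).prodMk htail (hU 0) (hV 0) (measurable_pi_lambda _ fun j => hU j.succ)
      (measurable_pi_lambda _ fun j => hV j.succ) hsplit).comp
      (measurable_fin_cons k) (measurable_fin_cons k)
    rw [Fin.sum_univ_succ]
    convert h using 1
    · funext ω j; cases j using Fin.cases <;> simp
    · funext ω j; cases j using Fin.cases <;> simp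

theorem isCovBound_of_measurableSet {Ω α β : Type*} [MeasurableSpace Ω] [MeasurableSpace α]
    [MeasurableSpace β] {P : Measure Ω} [IsProbabilityMeasure P] {U : Ω → α} {V : Ω → β}
    (hU : Measurable U) (hV : Measurable V) {c : ℝ}
    (hc : ∀ A B, MeasurableSet A → MeasurableSet B →
      |P.real (U ⁻¹' A ∩ V ⁻¹' B) - P.real (U ⁻¹' A) * P.real (V ⁻¹' B)| ≤ c) :
    IsCovBound P U V (4 * c) := fun a b ha hb hab hbb =>
  abs_covariance_le_of_superlevel (ha.comp hU) (hb.comp hV) (fun _ => hab _) (fun _ => hbb _)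
    fun s t => hc {x | s ≤ a x} {y | t ≤ b y} (measurableSet_le measurable_const ha)
      (measurableSet_le measurable_const hb)

theorem abs_cond_sub_le_one {Ω : Type*} [MeasurableSpace Ω] (P : Measure Ω)
    [IsProbabilityMeasure P] (A B : Set Ω) :
    |(P (A ∩ B) / P A).toReal - (P B).toReal| ≤ 1 := by
  have h : (P (A ∩ B) / P A).toReal ≤ 1 :=
    ENNReal.toReal_le_of_le_ofReal zero_le_one (by
      simpa using ENNReal.div_le_of_le_mul (by simpa using measure_mono Set.inter_subset_left))
  have h' : (P B).toReal ≤ 1 := measureReal_le_one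
  have h0 : 0 ≤ (P (A ∩ B) / P A).toReal := ENNReal.toReal_nonneg
  have h0' : 0 ≤ (P B).toReal := ENNReal.toReal_nonneg
  exact abs_le.2 ⟨by linarith, by linarith⟩

theorem phiDep_nonneg {Ω : Type*} (𝔊 ℌ : MeasurableSpace Ω) [MeasurableSpace Ω]
    (P : Measure Ω) : 0 ≤ phiDep P 𝔊 ℌ := by
  refine Real.sSup_nonneg ?_
  rintro x ⟨A, B, -, -, -, rfl⟩
  exact abs_nonneg _

theorem phiDep_le_one {Ω : Type*} (𝔊 ℌ : MeasurableSpace Ω) [MeasurableSpace Ω]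
    (P : Measure Ω) [IsProbabilityMeasure P] : phiDep P 𝔊 ℌ ≤ 1 := by
  refine Real.sSup_le ?_ zero_le_one
  rintro x ⟨A, B, -, -, -, rfl⟩
  exact abs_cond_sub_le_one P A B

theorem abs_measureReal_inter_sub_le_phiDep {Ω : Type*} {𝔊 ℌ : MeasurableSpace Ω}
    [MeasurableSpace Ω] (P : Measure Ω) [IsProbabilityMeasure P] {A B : Set Ω}
    (hA : MeasurableSet[𝔊] A) (hB : MeasurableSet[ℌ] B) :
    |P.real (A ∩ B) - P.real A * P.real B| ≤ phiDep P 𝔊 ℌ := by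
  rcases eq_or_ne (P A) 0 with h0 | h0
  · have h1 : P (A ∩ B) = 0 := measure_mono_null Set.inter_subset_left h0
    simpa [Measure.real, h0, h1] using phiDep_nonneg 𝔊 ℌ P
  · have hle : |(P (A ∩ B) / P A).toReal - (P B).toReal| ≤ phiDep P 𝔊 ℌ := by
      refine le_csSup ⟨1, ?_⟩ ⟨A, B, hA, hB, pos_iff_ne_zero.2 h0, rfl⟩
      rintro x ⟨A, B, -, -, -, rfl⟩
      exact abs_cond_sub_le_one P A B
    have hpos : 0 < P.real A := ENNReal.toReal_pos h0 (measure_ne_top _ _)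
    have e : P.real (A ∩ B) - P.real A * P.real B
        = P.real A * ((P (A ∩ B) / P A).toReal - (P B).toReal) := by
      rw [ENNReal.toReal_div]
      simp only [Measure.real] at hpos ⊢
      field_simp
    rw [e, abs_mul, abs_of_pos hpos]
    exact (mul_le_of_le_one_left (abs_nonneg _) measureReal_le_one).trans hle

theorem phiDep_le_mixPhi {Ω : Type*} [MeasurableSpace Ω] (P : Measure Ω) [IsProbabilityMeasure P]
    (F : ℤ → ℤ → MeasurableSpace Ω) (n : ℕ) (K : ℤ) :
    phiDep P (⨆ j : {j : ℤ // j ≤ K}, F j.1 K)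
      (⨆ m : {m : ℤ // K + (n : ℤ) ≤ m}, F (K + (n : ℤ)) m.1) ≤ mixPhi P F n := by
  refine le_ciSup (f := fun K : ℤ => phiDep P (⨆ j : {j : ℤ // j ≤ K}, F j.1 K)
      (⨆ m : {m : ℤ // K + (n : ℤ) ≤ m}, F (K + (n : ℤ)) m.1)) ⟨1, ?_⟩ K
  rintro x ⟨K, rfl⟩
  exact phiDep_le_one _ _ _

/-- Random variables observed up to time `K` and after time `K + n` have covariances controlled by
the mixing coefficient at lag `n`. -/
theorem isCovBound_mixPhi {Ω α β : Type*} [MeasurableSpace Ω] [MeasurableSpace α]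
    [MeasurableSpace β] {P : Measure Ω} [IsProbabilityMeasure P]
    {F : ℤ → ℤ → MeasurableSpace Ω} (hF : ∀ n m, F n m ≤ ‹MeasurableSpace Ω›)
    {U : Ω → α} {V : Ω → β} {K : ℤ} {n : ℕ}
    (hU : Measurable[⨆ j : {j : ℤ // j ≤ K}, F j.1 K] U)
    (hV : Measurable[⨆ m : {m : ℤ // K + (n : ℤ) ≤ m}, F (K + (n : ℤ)) m.1] V) :
    IsCovBound P U V (4 * mixPhi P F n) :=
  isCovBound_of_measurableSet (hU.mono (iSup_le fun _ => hF _ _) le_rfl)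
    (hV.mono (iSup_le fun _ => hF _ _) le_rfl) fun _ _ hA hB =>
      (abs_measureReal_inter_sub_le_phiDep P (hU hA) (hV hB)).trans (phiDep_le_mixPhi P F n K)

theorem prod_mem_Icc_neg_one_one {ι : Type*} (s : Finset ι) {g : ι → ℝ}
    (hg : ∀ i, g i ∈ Set.Icc (-1 : ℝ) 1) : ∏ i ∈ s, g i ∈ Set.Icc (-1 : ℝ) 1 := by
  refine abs_le.1 ?_
  rw [Finset.abs_prod]
  exact Finset.prod_le_one (fun _ _ => abs_nonneg _) fun i _ => abs_le.2 (hg i)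

/-- for `k` mutually independent copies of the filtered family, with
`Y_{n,r} = (X^{(1)}_{n,r},…,X^{(k)}_{kn,r})` and indices `n₁ < ⋯ < n_m` with gaps `> 2r`,
`|E[∏ f_s(Y_{n_s,r})] − ∏ E[f_s(Y_{n_s,r})]| ≤ 4 ∑_{j=1}^k ∑_{s=1}^{m−1} φ(j(n_{s+1}−n_s−2r))`. -/
theorem statement13
    {Ω : Type*} [MeasurableSpace Ω] (P : Measure Ω) [IsProbabilityMeasure P]
    {𝓧 : Type*} [MetricSpace 𝓧] [MeasurableSpace 𝓧] [BorelSpace 𝓧]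
    (k : ℕ) (hk : 0 < k)
    (F' : Fin k → ℤ → ℤ → MeasurableSpace Ω)
    (hFsub : ∀ (i : Fin k) (n m : ℤ), F' i n m ≤ ‹MeasurableSpace Ω›)
    (hFmono : ∀ (i : Fin k) (n m n₁ m₁ : ℤ), n₁ ≤ n → n ≤ m → m ≤ m₁ → F' i n m ≤ F' i n₁ m₁)
    (hindep : iIndep (fun i : Fin k => ⨆ p : ℤ × ℤ, F' i p.1 p.2) P)
    (φ : ℕ → ℝ) (hφ : ∀ (i : Fin k) (n : ℕ), mixPhi P (F' i) n = φ n)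
    (Xr : Fin k → ℕ → ℕ → Ω → 𝓧)
    (hXrmeas : ∀ (i : Fin k) (n r : ℕ),
      Measurable[F' i ((n : ℤ) - (r : ℤ)) ((n : ℤ) + (r : ℤ))] (Xr i n r))
    (m r : ℕ) (nn : ℕ → ℕ) (hpos : ∀ s, s < m → 0 < nn s)
    (hgap : ∀ s : ℕ, s + 1 < m → nn s + 2 * r < nn (s + 1))
    (f : ℕ → (Fin k → 𝓧) → ℝ)
    (hfmeas : ∀ s, Measurable (f s))
    (hfbdd : ∀ s x, f s x ∈ Set.Icc (-1 : ℝ) 1) :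
    |(∫ ω, ∏ s ∈ Finset.range m, f s (fun i : Fin k => Xr i (((i : ℕ) + 1) * nn s) r ω) ∂P)
        - ∏ s ∈ Finset.range m, ∫ ω, f s (fun i : Fin k => Xr i (((i : ℕ) + 1) * nn s) r ω) ∂P|
      ≤ 4 * ∑ j : Fin k, ∑ s ∈ Finset.range (m - 1),
          φ (((j : ℕ) + 1) * (nn (s + 1) - nn s - 2 * r)) := by
  let Y : ℕ → Ω → Fin k → 𝓧 := fun s ω i => Xr i (((i : ℕ) + 1) * nn s) r ω
  change |(∫ ω, ∏ s ∈ Finset.range m, f s (Y s ω) ∂P)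
    - ∏ s ∈ Finset.range m, ∫ ω, f s (Y s ω) ∂P| ≤ _
  induction m with
  | zero => simp
  | succ m ih =>
    have ih := ih (fun s hs => hpos s (by omega)) fun s hs => hgap s (by omega)
    cases m with
    | zero => simp
    | succ t =>
      have hmono : ∀ u s, s ≤ u → u ≤ t → nn s ≤ nn u := by
        intro u s hs
        induction u, hs using Nat.le_induction with
        | base => exact fun _ => le_rfl
        | succ u hu ihu =>
          intro hut
          have h₁ := ihu (by omega)
          have h₂ := hgap u (by omega)
          omega
      have hg := hgap t (by omega)
      have hcov : IsCovBound P (fun ω i (s : ℕ) => Xr i (((i : ℕ) + 1) * nn (min s t)) r ω)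
          (fun ω i => Xr i (((i : ℕ) + 1) * nn (t + 1)) r ω)
          (∑ j : Fin k, 4 * φ (((j : ℕ) + 1) * (nn (t + 1) - nn t - 2 * r))) := by
        have hXall : ∀ (i : Fin k) (n : ℕ), Measurable[⨆ p : ℤ × ℤ, F' i p.1 p.2] (Xr i n r) :=
          fun i n => (hXrmeas i n r).mono (le_iSup (fun p : ℤ × ℤ => F' i p.1 p.2) (_, _)) le_rfl
        have hXm : ∀ (i : Fin k) (n : ℕ), Measurable (Xr i n r) := fun i n =>
          (hXrmeas i n r).mono (hFsub _ _ _) le_rfl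
        refine IsCovBound.pi (fun j => ?_) (fun j => measurable_pi_lambda _ fun s => hXm _ _)
          (fun j => hXm _ _) ?_
        · rw [← hφ j]
          refine isCovBound_mixPhi (hFsub j)
            (K := (((j : ℕ) + 1) * nn t : ℕ) + (r : ℤ)) ?_ ?_
          · refine @measurable_pi_lambda _ _ _ (_) _ _ fun s => ?_
            have h : ((j : ℕ) + 1) * nn (min s t) ≤ ((j : ℕ) + 1) * nn t :=
              Nat.mul_le_mul_left _ (hmono t _ (min_le_right _ _) le_rfl)
            refine (hXrmeas j _ r).mono ?_ le_rfl
            refine le_trans (hFmono j _ _ _ ((((j : ℕ) + 1) * nn t : ℕ) + (r : ℤ)) le_rfl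
              (by omega) (by omega)) ?_
            exact le_iSup (fun i : {i : ℤ // i ≤ (((j : ℕ) + 1) * nn t : ℕ) + (r : ℤ)} =>
              F' j i.1 ((((j : ℕ) + 1) * nn t : ℕ) + (r : ℤ))) ⟨_, by omega⟩
          · have h : ((j : ℕ) + 1) * nn t + ((j : ℕ) + 1) * (nn (t + 1) - nn t - 2 * r) + 2 * r
                ≤ ((j : ℕ) + 1) * nn (t + 1) := by
              obtain ⟨d, hd⟩ := Nat.exists_eq_add_of_le hg.le
              have e : nn (t + 1) - nn t - 2 * r = d := by omega
              rw [e, hd]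
              nlinarith [Nat.zero_le ((j : ℕ) * r)]
            refine (hXrmeas j _ r).mono ?_ le_rfl
            refine le_trans (hFmono j _ _ ((((j : ℕ) + 1) * nn t : ℕ) + (r : ℤ)
              + (((j : ℕ) + 1) * (nn (t + 1) - nn t - 2 * r) : ℕ)) _
              (by omega) (by omega) le_rfl) ?_
            exact le_iSup (fun i : {i : ℤ // (((j : ℕ) + 1) * nn t : ℕ) + (r : ℤ)
              + (((j : ℕ) + 1) * (nn (t + 1) - nn t - 2 * r) : ℕ) ≤ i} =>
              F' j ((((j : ℕ) + 1) * nn t : ℕ) + (r : ℤ)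
              + (((j : ℕ) + 1) * (nn (t + 1) - nn t - 2 * r) : ℕ)) i.1) ⟨_, by omega⟩
        · refine iIndep_of_iIndep_of_le hindep fun j => Measurable.comap_le ?_
          exact @Measurable.prodMk _ _ _ _ _ (_) _ _
            (@measurable_pi_lambda _ _ _ (_) _ _ fun s => hXall _ _) (hXall _ _)
      have hstep := hcov (fun u => ∏ s ∈ Finset.range (t + 1), f s fun i => u i s) (f (t + 1))
        (Finset.measurable_fun_prod _ fun s _ => (hfmeas s).comp (by fun_prop)) (hfmeas _)
        (fun u => prod_mem_Icc_neg_one_one _ fun s => hfbdd s _) (hfbdd _)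
      have hprod : ∀ ω, ∏ s ∈ Finset.range (t + 1),
          f s (fun i => Xr i (((i : ℕ) + 1) * nn (min s t)) r ω)
          = ∏ s ∈ Finset.range (t + 1), f s (Y s ω) := fun ω =>
        Finset.prod_congr rfl fun s hs => by
          rw [min_eq_left (by simp at hs; omega)]
      simp only [hprod] at hstep
      have hE : |∫ ω, f (t + 1) (Y (t + 1) ω) ∂P| ≤ 1 :=
        abs_le.2 (integral_mem_Icc fun ω => hfbdd _ _)
      simp only [Nat.add_sub_cancel] at ih ⊢
      simp only [Finset.prod_range_succ _ (t + 1), Finset.sum_range_succ _ t]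
      rw [Finset.sum_add_distrib, mul_add, add_comm (4 * _)]
      rw [← Finset.mul_sum] at hstep
      refine (abs_sub_le _ ((∫ ω, ∏ s ∈ Finset.range (t + 1), f s (Y s ω) ∂P)
        * ∫ ω, f (t + 1) (Y (t + 1) ω) ∂P) _).trans (add_le_add hstep ?_)
      rw [← sub_mul, abs_mul]
      exact (mul_le_of_le_one_right (abs_nonneg _) hE).trans ih
end
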